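/- arXiv:math/0210369 — 7 statements merged into one kernel-verified Lean document; each statement's English description precedes it below -/
import Mathlib

section
/- Let n ≥ 1, let v > (n−1)/2, let x, y ∈ ℝⁿ and (p,q) ∈ ℤ × ℤⁿ be such that max(|x·q + p|, |y·q|) ≤ Π₊(q)^{-v/n}. Define β = (2v − n + 1)/(n(n+1)), r = Π₊(q)^{-β}, t_i = log(max(|q_i|,1)/r) for i = 1, …, n, σ = t₁ + ⋯ + tₙ, and γ = (2v − n + 1)/(2n(v+1)). Then each t_i ≥ 0, e^{((n−1)/(2n))σ} · max(|x·q + p|, |y·q|) ≤ r, e^{−t_i}|q_i| ≤ r for each i = 1, …, n, and r = e^{−γσ}. -/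
open MeasureTheory

theorem lemma_two_one (n : ℕ) (hn : 1 ≤ n) (v : ℝ) (hv : ((n : ℝ) - 1) / 2 < v)
    (x y : Fin n → ℝ) (p : ℤ) (q : Fin n → ℤ)
    (hineq : max |(∑ i, x i * (q i : ℝ)) + (p : ℝ)| |∑ i, y i * (q i : ℝ)| ≤
      (∏ i, max |(q i : ℝ)| 1) ^ (-(v / (n : ℝ))))
    (β r σ γ : ℝ) (t : Fin n → ℝ)
    (hβ : β = (2 * v - n + 1) / (n * (n + 1)))
    (hr : r = (∏ i, max |(q i : ℝ)| 1) ^ (-β))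
    (ht : ∀ i, t i = Real.log (max |(q i : ℝ)| 1 / r))
    (hσ : σ = ∑ i, t i)
    (hγ : γ = (2 * v - n + 1) / (2 * n * (v + 1))) :
    (∀ i, 0 ≤ t i) ∧
    Real.exp ((((n : ℝ) - 1) / (2 * n)) * σ) *
      max |(∑ i, x i * (q i : ℝ)) + (p : ℝ)| |∑ i, y i * (q i : ℝ)| ≤ r ∧
    (∀ i, Real.exp (-t i) * |(q i : ℝ)| ≤ r) ∧
    r = Real.exp (-γ * σ) := by
  have hn' : (1 : ℝ) ≤ n := by exact_mod_cast hn
  have hn0 : (n : ℝ) ≠ 0 := by positivity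
  have hn1 : (n : ℝ) + 1 ≠ 0 := by positivity
  have hv1 : v + 1 ≠ 0 := by
    have : 0 < v + 1 := by linarith
    exact this.ne'
  have hm1 : ∀ i, (1 : ℝ) ≤ max |(q i : ℝ)| 1 := fun i => le_max_right _ _
  have hm0 : ∀ i, (0 : ℝ) < max |(q i : ℝ)| 1 := fun i => lt_of_lt_of_le one_pos (hm1 i)
  have hβ0 : 0 ≤ β := by
    rw [hβ]
    apply div_nonneg
    · linarith
    · positivity
  have hP0 : 0 < ∏ i, max |(q i : ℝ)| 1 := Finset.prod_pos fun i _ => hm0 i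
  have hlog : Real.log (∏ i, max |(q i : ℝ)| 1) = ∑ i, Real.log (max |(q i : ℝ)| 1) :=
    Real.log_prod fun i _ => (hm0 i).ne'
  have hL0 : 0 ≤ Real.log (∏ i, max |(q i : ℝ)| 1) := by
    rw [hlog]
    exact Finset.sum_nonneg fun i _ => Real.log_nonneg (hm1 i)
  rw [Real.rpow_def_of_pos hP0] at hineq hr
  generalize Real.log (∏ i, max |(q i : ℝ)| 1) = L at *
  have hr0 : 0 < r := by rw [hr]; exact Real.exp_pos _
  have hlr : Real.log r = L * -β := by rw [hr, Real.log_exp]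
  have ht' : ∀ i, t i = Real.log (max |(q i : ℝ)| 1) + β * L := by
    intro i
    rw [ht, Real.log_div (hm0 i).ne' hr0.ne', hlr]
    ring
  have hσ' : σ = L * (2 * v + 2) / (n + 1) := by
    rw [hσ, Finset.sum_congr rfl fun i _ => ht' i, Finset.sum_add_distrib, ← hlog]
    simp only [Finset.sum_const, Finset.card_univ, Fintype.card_fin, nsmul_eq_mul]
    rw [hβ]
    field_simp
    ring
  refine ⟨?_, ?_, ?_, ?_⟩
  · intro i
    rw [ht' i]
    exact add_nonneg (Real.log_nonneg (hm1 i)) (mul_nonneg hβ0 hL0)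
  · refine (mul_le_mul_of_nonneg_left hineq (Real.exp_pos _).le).trans (le_of_eq ?_)
    rw [← Real.exp_add, hr, hσ', hβ]
    congr 1
    field_simp
    ring
  · intro i
    rw [ht, Real.exp_neg, Real.exp_log (div_pos (hm0 i) hr0), inv_div, div_mul_eq_mul_div,
      div_le_iff₀ (hm0 i)]
    exact mul_le_mul_of_nonneg_left (le_max_left _ _) hr0.le
  · rw [hr, hσ', hβ, hγ]
    congr 1
    field_simp
end

section
/- Let n ≥ 1, v > (n−1)/2, and let z = x + iy ∈ ℂⁿ be such that max(|x·q + p|, |y·q|) ≤ Π₊(q)^{-v/n} holds for infinitely many pairs (p,q) ∈ ℤ × ℤⁿ. Set γ = (2v − n + 1)/(2n(v+1)). Then the set of t ∈ [0,∞)ⁿ satisfying δ(g_t u_z Λ) ≤ e^{−γσ(t)} is unbounded, where δ is taken with respect to the sup norm on ℝ^{n+2} and σ(t) = t₁ + ⋯ + tₙ. -/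
open MeasureTheory

noncomputable def lamVec (n : ℕ) (p : ℤ) (q : Fin n → ℤ) : Fin (n + 2) → ℝ :=
  Fin.cons (p : ℝ) (Fin.cons 0 fun i => (q i : ℝ))

/-- The subgroup Λ = {(p, 0, q₁, …, qₙ)} of ℝ^{n+2}, as a set. -/
def LambdaSet (n : ℕ) : Set (Fin (n + 2) → ℝ) :=
  {w | ∃ (p : ℤ) (q : Fin n → ℤ), w = lamVec n p q}

/-- The action of the matrix u_z on ℝ^{n+2}. -/
noncomputable def uApply (n : ℕ) (z : Fin n → ℂ) (w : Fin (n + 2) → ℝ) : Fin (n + 2) → ℝ :=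
  w + Fin.cons (∑ i, (z i).re * w i.succ.succ)
        (Fin.cons (∑ i, (z i).im * w i.succ.succ) 0)

/-- The action of the diagonal matrix g_t on ℝ^{n+2}. -/
noncomputable def gApply (n : ℕ) (t : Fin n → ℝ) (w : Fin (n + 2) → ℝ) : Fin (n + 2) → ℝ :=
  fun j =>
    (Fin.cons (Real.exp ((((n : ℝ) - 1) / (2 * n)) * ∑ i, t i))
      (Fin.cons (Real.exp ((((n : ℝ) - 1) / (2 * n)) * ∑ i, t i))
        fun i => Real.exp (-t i)) : Fin (n + 2) → ℝ) j * w j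

/-- δ(S): the infimum of sup-norms of nonzero elements of S. -/
noncomputable def deltaSup (m : ℕ) (S : Set (Fin m → ℝ)) : ℝ :=
  sInf {r : ℝ | ∃ v ∈ S, v ≠ 0 ∧ ‖v‖ = r}

theorem key_bound (n : ℕ) (hn : 1 ≤ n) (v : ℝ) (hv : ((n : ℝ) - 1) / 2 < v)
    (z : Fin n → ℂ) (q : Fin n → ℤ) (p : ℤ) (hq : q ≠ 0)
    (h : max |(∑ i, (z i).re * (q i : ℝ)) + (p : ℝ)| |∑ i, (z i).im * (q i : ℝ)| ≤
        (∏ i, max |(q i : ℝ)| 1) ^ (-(v / (n : ℝ)))) :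
    ∃ t : Fin n → ℝ, (∀ i, 0 ≤ t i) ∧ (∀ i, |(q i : ℝ)| ≤ Real.exp (t i)) ∧
      deltaSup (n + 2) ((fun w => gApply n t (uApply n z w)) '' LambdaSet n) ≤
        Real.exp (-((2 * v - n + 1) / (2 * n * (v + 1))) * ∑ i, t i) := by
  have hn1 : (1 : ℝ) ≤ n := by exact_mod_cast hn
  have hv0 : 0 < v := by linarith
  set γ : ℝ := (2 * v - n + 1) / (2 * n * (v + 1)) with hγ
  have hγ0 : 0 ≤ γ := by
    apply div_nonneg
    · linarith
    · positivity
  set P : ℝ := ∏ i, max |(q i : ℝ)| 1 with hP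
  have hm : ∀ i, 1 ≤ max |(q i : ℝ)| 1 := fun i => le_max_right _ _
  have hP0 : 0 < P := Finset.prod_pos fun i _ => lt_of_lt_of_le one_pos (hm i)
  have hlogP : Real.log P = ∑ i, Real.log (max |(q i : ℝ)| 1) :=
    Real.log_prod fun i _ => (lt_of_lt_of_le one_pos (hm i)).ne'
  have hlog0 : ∀ i, 0 ≤ Real.log (max |(q i : ℝ)| 1) := fun i => Real.log_nonneg (hm i)
  have hLP : 0 ≤ Real.log P := by rw [hlogP]; exact Finset.sum_nonneg fun i _ => hlog0 i
  set s : ℝ := 2 * (v + 1) / (n + 1) * Real.log P with hs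
  have hs0 : 0 ≤ s := by positivity
  have hsum : ∑ i, (Real.log (max |(q i : ℝ)| 1) + γ * s) = s := by
    rw [Finset.sum_add_distrib, ← hlogP]
    simp only [Finset.sum_const, Finset.card_univ, Fintype.card_fin, nsmul_eq_mul]
    rw [hs, hγ]
    field_simp
    ring
  have hexp : Real.exp ((((n : ℝ) - 1) / (2 * n)) * s) * P ^ (-(v / (n : ℝ))) =
      Real.exp (-γ * s) := by
    rw [Real.rpow_def_of_pos hP0, ← Real.exp_add]
    congr 1
    rw [hs, hγ]
    field_simp
    ring
  refine ⟨fun i => Real.log (max |(q i : ℝ)| 1) + γ * s, fun i => ?_, fun i => ?_, ?_⟩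
  · have := hlog0 i
    positivity
  · rw [Real.exp_add, Real.exp_log (lt_of_lt_of_le one_pos (hm i))]
    have h1 : 1 ≤ Real.exp (γ * s) := Real.one_le_exp (by positivity)
    have h2 := le_max_left |(q i : ℝ)| 1
    nlinarith [hm i]
  · rw [hsum]
    set t : Fin n → ℝ := fun i => Real.log (max |(q i : ℝ)| 1) + γ * s with ht
    have hsum' : ∑ i, t i = s := hsum
    set w := gApply n t (uApply n z (lamVec n p q)) with hw
    have c0 : w 0 = Real.exp ((((n : ℝ) - 1) / (2 * n)) * s) *
        ((∑ i, (z i).re * (q i : ℝ)) + (p : ℝ)) := by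
      simp [hw, gApply, uApply, lamVec, hsum']
      ring
    have c1 : w (Fin.succ 0) = Real.exp ((((n : ℝ) - 1) / (2 * n)) * s) *
        (∑ i, (z i).im * (q i : ℝ)) := by
      simp only [hw, gApply, uApply, lamVec, hsum', Pi.add_apply, Fin.cons_succ, Fin.cons_zero,
        zero_add]
    have c2 : ∀ i : Fin n, w i.succ.succ = Real.exp (-t i) * (q i : ℝ) := by
      intro i
      simp only [hw, gApply, uApply, lamVec, Pi.add_apply, Fin.cons_succ, Pi.zero_apply, add_zero]
    have hw0 : w ≠ 0 := by
      intro h0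
      apply hq
      funext i
      have := c2 i
      rw [h0] at this
      simpa using this
    have hle : ‖w‖ ≤ Real.exp (-γ * s) := by
      rw [pi_norm_le_iff_of_nonneg (Real.exp_pos _).le]
      intro j
      refine Fin.cases ?_ (fun j => Fin.cases ?_ (fun i => ?_) j) j
      · rw [c0, norm_mul, Real.norm_eq_abs, Real.norm_eq_abs, Real.abs_exp, ← hexp]
        exact mul_le_mul_of_nonneg_left ((le_max_left _ _).trans h) (Real.exp_pos _).le
      · rw [c1, norm_mul, Real.norm_eq_abs, Real.norm_eq_abs, Real.abs_exp, ← hexp]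
        exact mul_le_mul_of_nonneg_left ((le_max_right _ _).trans h) (Real.exp_pos _).le
      · have hpos := lt_of_lt_of_le one_pos (hm i)
        rw [c2, norm_mul, Real.norm_eq_abs, Real.norm_eq_abs, Real.abs_exp]
        have : Real.exp (-t i) = (max |(q i : ℝ)| 1)⁻¹ * Real.exp (-γ * s) := by
          rw [ht]
          simp only
          rw [neg_add, Real.exp_add, Real.exp_neg, Real.exp_log hpos, neg_mul]
        rw [this, mul_right_comm]
        apply mul_le_of_le_one_left (Real.exp_pos _).le
        rw [inv_mul_le_iff₀ hpos, mul_one]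
        exact le_max_left _ _
    refine le_trans (csInf_le ⟨0, ?_⟩ ⟨w, ⟨lamVec n p q, ⟨p, q, rfl⟩, rfl⟩, hw0, rfl⟩) hle
    rintro r ⟨u, _, _, rfl⟩
    exact norm_nonneg u

theorem corollary_two_two (n : ℕ) (hn : 1 ≤ n) (v : ℝ) (hv : ((n : ℝ) - 1) / 2 < v)
    (z : Fin n → ℂ)
    (hinf : {pq : (Fin n → ℤ) × ℤ |
      max |(∑ i, (z i).re * (pq.1 i : ℝ)) + (pq.2 : ℝ)| |∑ i, (z i).im * (pq.1 i : ℝ)| ≤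
        (∏ i, max |(pq.1 i : ℝ)| 1) ^ (-(v / (n : ℝ)))}.Infinite) :
    ¬ Bornology.IsBounded {t : Fin n → ℝ | (∀ i, 0 ≤ t i) ∧
      deltaSup (n + 2) ((fun w => gApply n t (uApply n z w)) '' LambdaSet n) ≤
        Real.exp (-((2 * v - n + 1) / (2 * n * (v + 1))) * ∑ i, t i)} := by
  intro hb
  apply hinf
  obtain ⟨R, hR⟩ := hb.exists_norm_le
  have hn1 : (1 : ℝ) ≤ n := by exact_mod_cast hn
  have hv0 : 0 < v := by linarith
  set M : ℤ := ⌈Real.exp R⌉ with hM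
  set N : ℤ := ⌈1 + ∑ i, |(z i).re| * Real.exp R⌉ with hN
  have hfin : ((Set.Icc (fun _ : Fin n => -M) (fun _ => M)) ×ˢ (Set.Icc (-N) N)).Finite :=
    (Set.finite_Icc _ _).prod (Set.finite_Icc _ _)
  apply hfin.subset
  rintro ⟨q, p⟩ h
  simp only [Set.mem_setOf_eq] at h
  have hq : ∀ i, |(q i : ℝ)| ≤ Real.exp R := by
    intro i
    by_cases hq : q = 0
    · simp [hq, (Real.exp_pos R).le]
    · obtain ⟨t, ht0, htq, hd⟩ := key_bound n hn v hv z q p hq h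
      refine (htq i).trans (Real.exp_le_exp.2 ?_)
      exact (le_abs_self _).trans ((norm_le_pi_norm t i).trans (hR t ⟨ht0, hd⟩))
  have hp : |(p : ℝ)| ≤ 1 + ∑ i, |(z i).re| * Real.exp R := by
    have h1 : |(∑ i, (z i).re * (q i : ℝ)) + (p : ℝ)| ≤ 1 := by
      refine ((le_max_left _ _).trans h).trans
        (Real.rpow_le_one_of_one_le_of_nonpos ?_ ?_)
      · calc (1:ℝ) = ∏ _i : Fin n, (1:ℝ) := by simp
          _ ≤ _ := Finset.prod_le_prod (fun _ _ => zero_le_one) fun i _ => le_max_right _ _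
      · have : 0 ≤ v / n := by positivity
        linarith
    have h2 : |∑ i, (z i).re * (q i : ℝ)| ≤ ∑ i, |(z i).re| * Real.exp R := by
      refine (Finset.abs_sum_le_sum_abs _ _).trans (Finset.sum_le_sum fun i _ => ?_)
      rw [abs_mul]
      exact mul_le_mul_of_nonneg_left (hq i) (abs_nonneg _)
    rw [abs_le] at *
    constructor <;> linarith [h1.1, h1.2, h2.1, h2.2]
  have hq' : ∀ i, |q i| ≤ M := by
    intro i
    have := (hq i).trans (Int.le_ceil _)
    exact_mod_cast this
  have hp' : |p| ≤ N := by
    have := hp.trans (Int.le_ceil _)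
    exact_mod_cast this
  exact ⟨⟨fun i => (abs_le.1 (hq' i)).1, fun i => (abs_le.1 (hq' i)).2⟩,
    ⟨(abs_le.1 hp').1, (abs_le.1 hp').2⟩⟩
end

section
/- Let n ≥ 1 and let z = x + iy ∈ ℂⁿ be such that for some v > (n−1)/2 the inequality max(|x·q + p|, |y·q|) ≤ Π₊(q)^{-v/n} holds for infinitely many pairs (p,q) ∈ ℤ × ℤⁿ. Then there exists γ > 0 such that δ(g_t u_z Λ) ≤ e^{−γσ(t)} holds for infinitely many t ∈ ℤⁿ with all components nonnegative, where δ is taken with respect to the sup norm on ℝ^{n+2}. -/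
open MeasureTheory

lemma aux_unbdd (n : ℕ) (z : Fin n → ℂ) (v : ℝ) (hv : 0 ≤ v)
    (S : Set ((Fin n → ℤ) × ℤ)) (hS : S.Infinite)
    (hS' : ∀ pq ∈ S, max |(∑ i, (z i).re * (pq.1 i : ℝ)) + (pq.2 : ℝ)|
        |∑ i, (z i).im * (pq.1 i : ℝ)| ≤ (∏ i, max |(pq.1 i : ℝ)| 1) ^ (-(v / (n : ℝ))))
    (B : ℝ) : ∃ pq ∈ S, B < ∏ i, max |(pq.1 i : ℝ)| 1 := by
  by_contra hcon
  push Not at hcon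
  apply hS
  obtain ⟨M, hM⟩ := exists_nat_ge B
  obtain ⟨M', hM'⟩ := exists_nat_ge (1 + ∑ i, |(z i).re| * M)
  apply Set.Finite.subset ((Set.finite_Icc (fun _ : Fin n => -(M : ℤ)) (fun _ => (M : ℤ))).prod
    (Set.finite_Icc (-(M' : ℤ)) (M' : ℤ)))
  intro pq hpq
  have h1 : ∀ i, (1 : ℝ) ≤ max |(pq.1 i : ℝ)| 1 := fun i => le_max_right _ _
  have hP1 : (1 : ℝ) ≤ ∏ i, max |(pq.1 i : ℝ)| 1 := by
    have := Finset.prod_le_prod (s := Finset.univ) (f := fun _ : Fin n => (1 : ℝ))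
      (g := fun i => max |(pq.1 i : ℝ)| 1) (fun _ _ => zero_le_one) (fun i _ => h1 i)
    simpa using this
  have hq : ∀ i, |(pq.1 i : ℝ)| ≤ M := by
    intro i
    have h3 : max |(pq.1 i : ℝ)| 1 ≤ ∏ i, max |(pq.1 i : ℝ)| 1 := by
      rw [← Finset.mul_prod_erase _ _ (Finset.mem_univ i)]
      have := Finset.prod_le_prod (s := Finset.univ.erase i) (f := fun _ : Fin n => (1 : ℝ))
        (g := fun i => max |(pq.1 i : ℝ)| 1) (fun _ _ => zero_le_one) (fun i _ => h1 i)
      simp only [Finset.prod_const_one] at this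
      exact le_mul_of_one_le_right (by linarith [h1 i]) this
    exact (le_max_left _ _).trans (h3.trans ((hcon pq hpq).trans hM))
  have hle : (∏ i, max |(pq.1 i : ℝ)| 1) ^ (-(v / (n : ℝ))) ≤ 1 :=
    Real.rpow_le_one_of_one_le_of_nonpos hP1 (by
      have : 0 ≤ v / (n : ℝ) := by positivity
      linarith)
  have hx := ((le_max_left _ _).trans (hS' pq hpq)).trans hle
  have hsum : |∑ i, (z i).re * (pq.1 i : ℝ)| ≤ ∑ i, |(z i).re| * M := by
    refine (Finset.abs_sum_le_sum_abs _ _).trans (Finset.sum_le_sum fun i _ => ?_)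
    rw [abs_mul]
    exact mul_le_mul_of_nonneg_left (hq i) (abs_nonneg _)
  have hp : |(pq.2 : ℝ)| ≤ M' := by
    rw [abs_le] at *
    constructor <;> linarith [hx.1, hx.2, hsum.1, hsum.2]
  refine ⟨⟨fun i => ?_, fun i => ?_⟩, ?_, ?_⟩
  · have := (abs_le.1 (hq i)).1
    exact_mod_cast this
  · have := (abs_le.1 (hq i)).2
    exact_mod_cast this
  · have := (abs_le.1 hp).1
    exact_mod_cast this
  · have := (abs_le.1 hp).2
    exact_mod_cast this

lemma aux_delta (n : ℕ) (z : Fin n → ℂ) (t : Fin n → ℝ) (p : ℤ) (q : Fin n → ℤ)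
    (r : ℝ) (hr : 0 ≤ r) (hq : q ≠ 0)
    (h0 : Real.exp ((((n : ℝ) - 1) / (2 * n)) * ∑ i, t i) *
      |(∑ i, (z i).re * (q i : ℝ)) + (p : ℝ)| ≤ r)
    (h1 : Real.exp ((((n : ℝ) - 1) / (2 * n)) * ∑ i, t i) *
      |∑ i, (z i).im * (q i : ℝ)| ≤ r)
    (h2 : ∀ i, Real.exp (-t i) * |(q i : ℝ)| ≤ r) :
    deltaSup (n + 2) ((fun w => gApply n t (uApply n z w)) '' LambdaSet n) ≤ r := by
  have hb : BddBelow {r : ℝ | ∃ v ∈ ((fun w => gApply n t (uApply n z w)) '' LambdaSet n),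
      v ≠ 0 ∧ ‖v‖ = r} := by
    refine ⟨0, ?_⟩
    rintro _ ⟨v, _, _, rfl⟩
    exact norm_nonneg _
  have c2 : ∀ i : Fin n, gApply n t (uApply n z (lamVec n p q)) i.succ.succ
      = Real.exp (-t i) * (q i : ℝ) := by
    intro i
    simp [gApply, uApply, lamVec]
  refine (csInf_le hb ⟨_, ⟨lamVec n p q, ⟨p, q, rfl⟩, rfl⟩, ?_, rfl⟩).trans ?_
  · intro h
    apply hq
    funext i
    have := congrFun h i.succ.succ
    simp only [c2] at this
    simpa [Real.exp_ne_zero] using this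
  · rw [pi_norm_le_iff_of_nonneg hr]
    intro j
    refine Fin.cases ?_ (fun j => Fin.cases ?_ (fun i => ?_) j) j
    · simp only [gApply, uApply, lamVec, Pi.add_apply, Fin.cons_zero, Fin.cons_succ,
        Real.norm_eq_abs, abs_mul, Real.abs_exp]
      rwa [add_comm (p : ℝ)]
    · simp only [gApply, uApply, lamVec, Pi.add_apply, Fin.cons_zero, Fin.cons_succ,
        Real.norm_eq_abs, abs_mul, Real.abs_exp, zero_add]
      exact h1
    · simp only [c2, Real.norm_eq_abs, abs_mul, Real.abs_exp]
      exact h2 i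

theorem corollary_two_three (n : ℕ) (hn : 1 ≤ n) (z : Fin n → ℂ)
    (h : ∃ v : ℝ, ((n : ℝ) - 1) / 2 < v ∧
      {pq : (Fin n → ℤ) × ℤ |
        max |(∑ i, (z i).re * (pq.1 i : ℝ)) + (pq.2 : ℝ)| |∑ i, (z i).im * (pq.1 i : ℝ)| ≤
          (∏ i, max |(pq.1 i : ℝ)| 1) ^ (-(v / (n : ℝ)))}.Infinite) :
    ∃ γ : ℝ, 0 < γ ∧
      {t : Fin n → ℤ | (∀ i, 0 ≤ t i) ∧
        deltaSup (n + 2)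
          ((fun w => gApply n (fun i => (t i : ℝ)) (uApply n z w)) '' LambdaSet n) ≤
          Real.exp (-γ * ∑ i, (t i : ℝ))}.Infinite := by
  obtain ⟨v, hv, hinf⟩ := h
  have hn1 : (1 : ℝ) ≤ n := by exact_mod_cast hn
  have hn0 : (0 : ℝ) < n := by linarith
  have hv0 : 0 ≤ v := by linarith
  obtain ⟨ε, hε⟩ : ∃ ε : ℝ, ε = (2 * v - (n - 1)) / n := ⟨_, rfl⟩
  have hεn : n * ε = 2 * v - (n - 1) := by rw [hε]; field_simp
  have hε0 : 0 < ε := by rw [hε]; apply div_pos <;> linarith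
  obtain ⟨γ, hγ⟩ : ∃ γ : ℝ, γ = ε / (2 * n * (1 + ε)) := ⟨_, rfl⟩
  have hγ0 : 0 < γ := by rw [hγ]; positivity
  have hγe : γ * (1 + ε) = ε / (2 * n) := by rw [hγ]; field_simp
  refine ⟨γ, hγ0, ?_⟩
  intro hfin
  obtain ⟨N, hN⟩ := (hfin.image (fun t : Fin n → ℤ => ∑ i, (t i : ℝ))).bddAbove
  obtain ⟨⟨q, p⟩, hpq, hB⟩ := aux_unbdd n z v hv0 _ hinf (fun _ h => h)
    (Real.exp (max (max N 0) (2 * n / ε)))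
  obtain ⟨P, hP⟩ : ∃ P : ℝ, P = ∏ i, max |(q i : ℝ)| 1 := ⟨_, rfl⟩
  obtain ⟨L, hL⟩ : ∃ L : ℝ, L = Real.log P := ⟨_, rfl⟩
  simp only [← hP] at hB
  have hP0 : 0 < P := (Real.exp_pos _).trans hB
  have hLB : max (max N 0) (2 * n / ε) < L := by rw [hL]; exact (Real.lt_log_iff_exp_lt hP0).2 hB
  have hLN : N < L := lt_of_le_of_lt ((le_max_left _ _).trans (le_max_left _ _)) hLB
  have hL0 : 0 < L := lt_of_le_of_lt ((le_max_right _ _).trans (le_max_left _ _)) hLB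
  have hLn : (n : ℝ) ≤ ε / 2 * L := by
    have := lt_of_le_of_lt (le_max_right _ _) hLB
    rw [div_lt_iff₀ hε0] at this
    linarith
  have hm : ∀ i, (0 : ℝ) < max |(q i : ℝ)| 1 := fun i => lt_of_lt_of_le one_pos (le_max_right _ _)
  have hLs : L = ∑ i, Real.log (max |(q i : ℝ)| 1) := by
    rw [hL, hP, Real.log_prod (fun i _ => (hm i).ne')]
  have hlog : ∀ i, 0 ≤ Real.log (max |(q i : ℝ)| 1) := fun i => Real.log_nonneg (le_max_right _ _)
  let t : Fin n → ℤ := fun i => ⌈Real.log (max |(q i : ℝ)| 1) + ε / (2 * n) * L⌉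
  have ht1 : ∀ i, Real.log (max |(q i : ℝ)| 1) + ε / (2 * n) * L ≤ (t i : ℝ) :=
    fun i => Int.le_ceil _
  have ht2 : ∀ i, (t i : ℝ) ≤ Real.log (max |(q i : ℝ)| 1) + ε / (2 * n) * L + 1 :=
    fun i => (Int.ceil_lt_add_one _).le
  have hc0 : 0 < ε / (2 * n) * L := by positivity
  have hnc : n * (ε / (2 * n) * L) = ε / 2 * L := by field_simp
  clear_value t
  obtain ⟨s, hs⟩ : ∃ s : ℝ, s = ∑ i, (t i : ℝ) := ⟨_, rfl⟩
  have hs1 : L ≤ s := by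
    rw [hs, hLs]
    exact Finset.sum_le_sum fun i _ => by linarith [ht1 i]
  have hs2 : s ≤ (1 + ε) * L := by
    have := Finset.sum_le_sum (s := Finset.univ) fun i _ => ht2 i
    simp only [Finset.sum_add_distrib, Finset.sum_const, Finset.card_univ, Fintype.card_fin,
      nsmul_eq_mul, mul_one, ← hLs, ← hs, hnc] at this
    linarith
  have hgs : γ * s ≤ ε / (2 * n) * L := by
    rw [← hγe, mul_assoc]
    exact mul_le_mul_of_nonneg_left hs2 hγ0.le
  have hmem : t ∈ {t : Fin n → ℤ | (∀ i, 0 ≤ t i) ∧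
        deltaSup (n + 2)
          ((fun w => gApply n (fun i => (t i : ℝ)) (uApply n z w)) '' LambdaSet n) ≤
          Real.exp (-γ * ∑ i, (t i : ℝ))} := by
    refine ⟨fun i => ?_, ?_⟩
    · have : (0 : ℝ) ≤ t i := by linarith [ht1 i, hlog i]
      exact_mod_cast this
    have hPv : P ^ (-(v / (n : ℝ))) = Real.exp (-(v / n) * L) := by
      rw [Real.rpow_def_of_pos hP0, ← hL, mul_comm]
    have hmain : (((n : ℝ) - 1) / (2 * n)) * s + (-(v / n) * L) ≤ -γ * s := by
      have hA : ((n : ℝ) - 1) * s ≤ (n - 1) * ((1 + ε) * L) :=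
        mul_le_mul_of_nonneg_left hs2 (by linarith)
      have hB' : n * (γ * s) ≤ ε / 2 * L := by
        rw [← hnc]; exact mul_le_mul_of_nonneg_left hgs hn0.le
      have hC : (n * ε) * L = (2 * v - (n - 1)) * L := by rw [hεn]
      have e : (((n : ℝ) - 1) / (2 * n)) * s + (-(v / n) * L) - (-γ * s)
        = ((n - 1) * s - 2 * v * L + 2 * (n * (γ * s))) / (2 * n) := by field_simp; ring
      have : ((n - 1) * s - 2 * v * L + 2 * (n * (γ * s))) / (2 * n) ≤ 0 :=
        div_nonpos_of_nonpos_of_nonneg (by linarith) (by positivity)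
      linarith
    have hpq' : max |(∑ i, (z i).re * (q i : ℝ)) + (p : ℝ)| |∑ i, (z i).im * (q i : ℝ)| ≤
          Real.exp (-(v / n) * L) := by
      rw [← hPv, hP]; exact hpq
    have key : ∀ a : ℝ, a ≤ Real.exp (-(v / n) * L) →
        Real.exp ((((n : ℝ) - 1) / (2 * n)) * s) * a ≤ Real.exp (-γ * s) := by
      intro a ha
      refine (mul_le_mul_of_nonneg_left ha (Real.exp_pos _).le).trans ?_
      rw [← Real.exp_add]
      exact Real.exp_le_exp.2 hmain
    apply aux_delta n z _ p q _ (Real.exp_pos _).le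
    · rintro rfl
      simp at hLs
      linarith
    · rw [← hs]; exact key _ ((le_max_left _ _).trans hpq')
    · rw [← hs]; exact key _ ((le_max_right _ _).trans hpq')
    · intro i
      rw [← hs]
      refine (mul_le_mul_of_nonneg_left (le_max_left _ 1) (Real.exp_pos _).le).trans ?_
      rw [← Real.exp_log (hm i), ← Real.exp_add]
      apply Real.exp_le_exp.2
      linarith [ht1 i]
  have := hN ⟨t, hmem, rfl⟩
  simp only [← hs] at this
  linarith
end

section
/- Let d, n ≥ 1, let U ⊆ ℝ^d be a connected open set, and let f = (f₁, …, fₙ) : U → ℝⁿ be a real analytic map. Then for every x₀ ∈ U there exist a neighborhood V ⊆ U of x₀ and constants C, α > 0 such that for every (c₀, c₁, …, cₙ) ∈ ℝ^{n+1}, the function x ↦ c₀ + c₁f₁(x) + ⋯ + cₙfₙ(x) is (C,α)-good on V. -/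
open MeasureTheory

/-- f is (C,α)-good on V ⊆ ℝ^d. -/
def IsGood {d : ℕ} (C α : ℝ) (V : Set (Fin d → ℝ)) (f : (Fin d → ℝ) → ℝ) : Prop :=
  ∀ (x : Fin d → ℝ) (r : ℝ), Metric.ball x r ⊆ V → ∀ ε : ℝ, 0 < ε →
    volume {y ∈ Metric.ball x r | |f y| < ε * ⨆ w ∈ Metric.ball x r, |f w|} ≤
      ENNReal.ofReal (C * ε ^ α) * volume (Metric.ball x r)

lemma aux_rolle (a b : ℝ) : ∀ (k : ℕ) (φ : ℕ → ℝ → ℝ)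
    (_ : ∀ j < k, ∀ t ∈ Set.Ioo a b, HasDerivAt (φ j) (φ (j+1) t) t)
    (t : Fin (k+1) → ℝ) (_ : StrictMono t) (_ : ∀ i, t i ∈ Set.Ioo a b)
    (_ : ∀ i, φ 0 (t i) = 0), ∃ ξ ∈ Set.Ioo a b, φ k ξ = 0 := by
  intro k
  induction k with
  | zero => intro φ _ t _ h1 h2; exact ⟨t 0, h1 0, h2 0⟩
  | succ k ih =>
    intro φ hφ t ht h1 h2
    have key : ∀ i : Fin (k+1), ∃ ξ ∈ Set.Ioo (t i.castSucc) (t i.succ), φ 1 ξ = 0 := by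
      intro i
      have hlt : t i.castSucc < t i.succ := ht (Fin.castSucc_lt_succ)
      have hsub : ∀ x ∈ Set.Icc (t i.castSucc) (t i.succ), x ∈ Set.Ioo a b := fun x hx =>
        ⟨(h1 _).1.trans_le hx.1, hx.2.trans_lt (h1 _).2⟩
      exact exists_hasDerivAt_eq_zero hlt
        (fun x hx => (hφ 0 (Nat.succ_pos k) x (hsub x hx)).continuousAt.continuousWithinAt)
        (by rw [h2, h2])
        (fun x hx => hφ 0 (Nat.succ_pos k) x (hsub x ⟨hx.1.le, hx.2.le⟩))
    choose ξ hξ hξ0 using key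
    obtain ⟨z, hz, hz0⟩ := ih (fun j => φ (j+1)) (fun j hj => hφ (j+1) (by omega)) ξ
      (by
        intro i j hij
        have h3 : t i.succ ≤ t j.castSucc := ht.monotone (by
          rw [Fin.le_def]; simp; exact hij)
        exact (hξ i).2.trans_le (h3.trans (hξ j).1.le))
      (fun i => ⟨(h1 _).1.trans (hξ i).1, (hξ i).2.trans (h1 _).2⟩) hξ0
    exact ⟨z, hz, hz0⟩

lemma aux_divdiff (a b : ℝ) (k : ℕ) (φ : ℕ → ℝ → ℝ)
    (hφ : ∀ j < k, ∀ t ∈ Set.Ioo a b, HasDerivAt (φ j) (φ (j+1) t) t)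
    (T : Finset ℝ) (hT : T.card = k + 1) (hTs : ∀ t ∈ T, t ∈ Set.Ioo a b) :
    ∃ ξ ∈ Set.Ioo a b, φ k ξ =
      k.factorial * ∑ i ∈ T, φ 0 i / ∏ j ∈ T.erase i, (i - j) := by
  classical
  have hinj : Set.InjOn (id : ℝ → ℝ) T := Function.injective_id.injOn
  set P := Lagrange.interpolate T id (φ 0) with hP
  have hdeg : P.degree < T.card := Lagrange.degree_interpolate_lt _ hinj
  obtain ⟨ξ, hξ, h0⟩ := aux_rolle a b k
    (fun j t => φ j t - (Polynomial.derivative^[j] P).eval t)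
    (fun j hj t ht => by
      have := (hφ j hj t ht).sub ((Polynomial.derivative^[j] P).hasDerivAt t)
      rw [Function.iterate_succ_apply']
      exact this)
    (T.orderEmbOfFin hT) (T.orderEmbOfFin hT).strictMono
    (fun i => hTs _ (T.orderEmbOfFin_mem hT i))
    (fun i => by
      have := Lagrange.eval_interpolate_at_node (φ 0) hinj (T.orderEmbOfFin_mem hT i)
      simp only [id] at this
      simp only [Function.iterate_zero, id]
      rw [hP, this, sub_self])
  refine ⟨ξ, hξ, ?_⟩
  rw [sub_eq_zero] at h0
  rw [h0, Lagrange.eval_iterate_derivative_eq_sum hinj hdeg (by omega)]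
  congr 1
  apply Finset.sum_congr rfl
  intro i hi
  have := Lagrange.eval_interpolate_at_node (φ 0) hinj hi
  simp only [id] at this
  rw [← hP] at this
  simp [hT, this]

lemma aux_points (E : Set ℝ) (t0 δ : ℝ) (hδ : 0 < δ) : ∀ (N : ℕ)
    (_ : ENNReal.ofReal (2 * N * δ) < volume E),
    ∃ T : Finset ℝ, T.card = N ∧ t0 ∉ T ∧ (∀ t ∈ T, t ∈ E) ∧
      ∀ x ∈ insert t0 T, ∀ y ∈ insert t0 T, x ≠ y → δ ≤ |x - y| := by
  intro N
  induction N with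
  | zero => intro _; exact ⟨∅, by simp, by simp, by simp, by simp +contextual⟩
  | succ N ih =>
    intro hE
    obtain ⟨T, hc, h0, hTE, hsep⟩ := ih (lt_of_le_of_lt (ENNReal.ofReal_le_ofReal (by
      push_cast; nlinarith)) hE)
    have : ¬ E ⊆ ⋃ t ∈ insert t0 T, Metric.ball t δ := by
      intro hsub
      have h1 := measure_mono (μ := volume) hsub
      have h2 := measure_biUnion_finset_le (μ := volume) (insert t0 T) (fun t => Metric.ball t δ)
      have h3 : ∑ t ∈ insert t0 T, volume (Metric.ball t δ) = ENNReal.ofReal (2 * (N+1 : ℕ) * δ) := by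
        simp only [Real.volume_ball, Finset.sum_const, Finset.card_insert_of_notMem h0, hc]
        rw [nsmul_eq_mul, ← ENNReal.ofReal_natCast, ← ENNReal.ofReal_mul (by positivity)]
        congr 1; ring
      exact absurd hE (not_lt.2 (h1.trans (h2.trans h3.le)))
    rw [Set.not_subset] at this
    obtain ⟨z, hz, hzn⟩ := this
    simp only [Set.mem_iUnion, Metric.mem_ball, not_exists, not_lt, Real.dist_eq] at hzn
    refine ⟨insert z T, ?_, ?_, ?_, ?_⟩
    · rw [Finset.card_insert_of_notMem, hc]
      intro hzT
      have := hzn z (Finset.mem_insert_of_mem hzT)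
      simp at this; linarith
    · intro h
      rw [Finset.mem_insert] at h
      rcases h with h | h
      · have := hzn t0 (Finset.mem_insert_self _ _)
        simp [h] at this; linarith
      · exact h0 h
    · intro t ht
      rw [Finset.mem_insert] at ht
      rcases ht with rfl | ht
      · exact hz
      · exact hTE t ht
    · intro x hx y hy hxy
      rw [Finset.insert_comm, Finset.mem_insert] at hx hy
      rcases hx with rfl | hx <;> rcases hy with rfl | hy
      · exact absurd rfl hxy
      · exact hzn y hy
      · rw [abs_sub_comm]; exact hzn x hx
      · exact hsep x hx y hy hxy

lemma aux_1d (k : ℕ) (K : ℝ) (hK : 0 < K) (a b : ℝ) (hab : a < b) (φ : ℕ → ℝ → ℝ)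
    (hφ : ∀ j < k, ∀ t ∈ Set.Ioo a b, HasDerivAt (φ j) (φ (j+1) t) t)
    (A : ℝ) (hA : 0 < A) (hlo : ∀ t ∈ Set.Ioo a b, A ≤ |φ k t|)
    (hhi : ∀ t ∈ Set.Ioo a b, |φ k t| ≤ K * A) (t0 : ℝ) (ht0 : t0 ∈ Set.Ioo a b)
    (ε : ℝ) (hε : 0 < ε) :
    volume {t ∈ Set.Ioo a b | |φ 0 t| < ε * |φ 0 t0|} ≤
      ENNReal.ofReal (((2 * (k + 1)) ^ k * ((K + 1) * (k + 1)) + 1) * ε ^ (1 / ((k : ℝ) + 1)))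
        * volume (Set.Ioo a b) := by
  classical
  by_contra hcon
  rw [not_le] at hcon
  set E := {t ∈ Set.Ioo a b | |φ 0 t| < ε * |φ 0 t0|} with hE
  set M : ℝ := (2 * (k + 1)) ^ k * ((K + 1) * (k + 1)) with hM
  have hMpos : 0 < M := by positivity
  set x : ℝ := (M + 1) * ε ^ (1 / ((k : ℝ) + 1)) with hx
  have hxpos : 0 < x := by positivity
  set D := b - a with hD
  have hDpos : 0 < D := sub_pos.2 hab
  rw [Real.volume_Ioo, ← ENNReal.ofReal_mul hxpos.le] at hcon
  have hx1 : x ≤ 1 := by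
    have h1 : volume E ≤ ENNReal.ofReal D := by
      rw [← Real.volume_Ioo]; exact measure_mono (fun t ht => ht.1)
    have h2 := (ENNReal.ofReal_lt_ofReal_iff hDpos).1 (hcon.trans_le h1)
    have : x * D < 1 * D := by linarith
    exact (lt_of_mul_lt_mul_right this hDpos.le).le
  set δ := x * D / (2 * (k + 1)) with hδ
  have hδpos : 0 < δ := by positivity
  obtain ⟨T, hc, hn, hTE, hsep⟩ := aux_points E t0 δ hδpos (k+1) (by
    convert hcon using 2
    rw [hδ]; push_cast; field_simp; rw [hD])
  set s := |φ 0 t0| with hs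
  have hprod : ∀ S : Finset ℝ, S ⊆ insert t0 T → S.card = k → ∀ i ∈ insert t0 T, i ∉ S →
      δ ^ k ≤ |∏ j ∈ S, (i - j)| := by
    intro S hS hSc i hi hiS
    rw [Finset.abs_prod, ← hSc, ← Finset.prod_const]
    apply Finset.prod_le_prod
    · intros; exact hδpos.le
    · intro j hj
      exact hsep i hi j (hS hj) (fun h => hiS (h ▸ hj))
  have hterm : ∀ S : Finset ℝ, S ⊆ insert t0 T → S.card = k + 1 → ∀ i ∈ T, i ∈ S → 
      |φ 0 i / ∏ j ∈ S.erase i, (i - j)| ≤ ε * s / δ ^ k := by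
    intro S hS hSc i hi hiS
    rw [abs_div]
    apply div_le_div₀ (by positivity) (hTE i hi).2.le (by positivity)
    exact hprod _ ((Finset.erase_subset _ _).trans hS) (by rw [Finset.card_erase_of_mem hiS, hSc]; simp)
      i (Finset.mem_insert_of_mem hi) (by simp)
  have hkf : (0:ℝ) < k.factorial := by positivity
  -- first estimate
  have e1 : A ≤ k.factorial * ((k + 1) * (ε * s / δ ^ k)) := by
    obtain ⟨ξ, hξ, h⟩ := aux_divdiff a b k φ hφ T hc (fun t ht => (hTE t ht).1)
    refine (hlo ξ hξ).trans ?_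
    rw [h, abs_mul, abs_of_pos hkf]
    apply mul_le_mul_of_nonneg_left _ hkf.le
    refine (Finset.abs_sum_le_sum_abs _ _).trans ?_
    refine (Finset.sum_le_card_nsmul _ _ _ (fun i hi =>
      hterm T (Finset.subset_insert _ _) hc i hi hi)).trans ?_
    rw [hc, nsmul_eq_mul]; push_cast; rfl
  -- second estimate
  obtain ⟨t1, ht1⟩ : T.Nonempty := Finset.card_pos.1 (by omega)
  have hspos : 0 < s := by
    have := (hTE t1 ht1).2
    have h2 := abs_nonneg (φ 0 t1)
    by_contra hneg
    nlinarith
  have e2 : s ≤ D ^ k * (K * A / k.factorial + k * (ε * s / δ ^ k)) := by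
    have hnS : t0 ∉ T.erase t1 := fun h => hn (Finset.mem_of_mem_erase h)
    have hcS : (T.erase t1).card = k := by rw [Finset.card_erase_of_mem ht1, hc]; simp
    have hcI : (insert t0 (T.erase t1)).card = k + 1 := by
      rw [Finset.card_insert_of_notMem hnS, hcS]
    have hsubI : insert t0 (T.erase t1) ⊆ insert t0 T :=
      Finset.insert_subset_insert _ (Finset.erase_subset _ _)
    obtain ⟨ξ, hξ, h⟩ := aux_divdiff a b k φ hφ (insert t0 (T.erase t1)) hcI (by
      intro t ht
      rw [Finset.mem_insert] at ht
      rcases ht with rfl | ht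
      · exact ht0
      · exact (hTE t (Finset.mem_of_mem_erase ht)).1)
    rw [Finset.sum_insert hnS, Finset.erase_insert hnS] at h
    set PP := ∏ j ∈ T.erase t1, (t0 - j) with hPi
    set R := ∑ i ∈ T.erase t1, φ 0 i / ∏ j ∈ (insert t0 (T.erase t1)).erase i, (i - j) with hR
    have hPilo : δ ^ k ≤ |PP| := hprod _ ((Finset.erase_subset _ _).trans (Finset.subset_insert _ _))
      hcS t0 (Finset.mem_insert_self _ _) hnS
    have hPihi : |PP| ≤ D ^ k := by
      rw [hPi, Finset.abs_prod, ← hcS, ← Finset.prod_const]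
      apply Finset.prod_le_prod
      · intros; positivity
      · intro j hj
        have := (hTE j (Finset.mem_of_mem_erase hj)).1
        rw [abs_le]
        constructor <;> linarith [this.1, this.2, ht0.1, ht0.2]
    have hPine : PP ≠ 0 := by
      intro h0
      rw [h0, abs_zero] at hPilo
      exact absurd hPilo (not_le.2 (by positivity))
    have hRb : |R| ≤ k * (ε * s / δ ^ k) := by
      refine (Finset.abs_sum_le_sum_abs _ _).trans ?_
      refine (Finset.sum_le_card_nsmul _ _ _ (fun i hi =>
        hterm _ hsubI hcI i (Finset.mem_of_mem_erase hi) (Finset.mem_insert_of_mem hi))).trans ?_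
      rw [hcS, nsmul_eq_mul]
    have heq : φ 0 t0 = PP * (φ k ξ / k.factorial - R) := by
      rw [h]; field_simp; ring
    have hs2 : s = |PP| * |φ k ξ / k.factorial - R| := by rw [hs, heq, abs_mul]
    refine hs2.le.trans ?_
    apply mul_le_mul hPihi _ (abs_nonneg _) (by positivity)
    refine (abs_sub _ _).trans ?_
    apply add_le_add _ hRb
    rw [abs_div, abs_of_pos hkf]
    exact div_le_div_of_nonneg_right (hhi ξ hξ) hkf.le
  have e3 : K * A / k.factorial ≤ K * ((k + 1) * (ε * s / δ ^ k)) := by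
    rw [div_le_iff₀ hkf]
    calc K * A ≤ K * (k.factorial * ((k + 1) * (ε * s / δ ^ k))) :=
          mul_le_mul_of_nonneg_left e1 hK.le
      _ = _ := by ring
  have hQ : 0 < ε * s / δ ^ k := by positivity
  have e4 : s ≤ D ^ k * (((K + 1) * (k + 1)) * (ε * s / δ ^ k)) := by
    refine e2.trans (mul_le_mul_of_nonneg_left ?_ (by positivity))
    nlinarith
  have e5 : x ^ k ≤ M * ε := by
    have hδk : δ ^ k = x ^ k * D ^ k / (2 * (k + 1)) ^ k := by
      rw [hδ, div_pow, mul_pow]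
    have : D ^ k * (((K + 1) * (k + 1)) * (ε * s / δ ^ k)) = s * (M * ε / x ^ k) := by
      rw [hδk, hM]; field_simp
    rw [this] at e4
    have h1 : 1 ≤ M * ε / x ^ k := by
      by_contra hneg
      rw [not_le] at hneg
      nlinarith
    rwa [one_le_div (by positivity)] at h1
  have e6 : x ^ (k+1) = (M+1)^(k+1) * ε := by
    rw [hx, mul_pow, ← Real.rpow_natCast (ε ^ _), ← Real.rpow_mul hε.le]
    push_cast
    rw [one_div, inv_mul_cancel₀ (by positivity), Real.rpow_one]
  have e7 : x ^ (k+1) ≤ x ^ k := pow_le_pow_of_le_one hxpos.le hx1 (by omega)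
  have e8 : M + 1 ≤ (M+1)^(k+1) := le_self_pow₀ (by linarith) (by omega)
  nlinarith

lemma aux_prod (C α : ℝ) : ∀ (d : ℕ) (h : (Fin d → ℝ) → ℝ)
    (_ : Measurable h) (y : Fin d → ℝ) (r : ℝ) (_ : 0 < r)
    (_ : ∀ x ∈ Metric.ball y r, ∀ i, ∀ ε > 0,
      volume {t ∈ Metric.ball (y i) r | |h (Function.update x i t)| < ε * |h x|} ≤
        ENNReal.ofReal (C * ε ^ α) * ENNReal.ofReal (2 * r)),
    ∀ p ∈ Metric.ball y r, ∀ ε > 0,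
      volume {x ∈ Metric.ball y r | |h x| < ε ^ d * |h p|} ≤
        d * (ENNReal.ofReal (C * ε ^ α) * ENNReal.ofReal (2 * r) ^ d) := by
  intro d
  induction d with
  | zero =>
    intro h _ y r hr _ p hp ε hε
    have : {x ∈ Metric.ball y r | |h x| < ε ^ 0 * |h p|} = ∅ := by
      ext x
      simp [Subsingleton.elim x p]
    rw [this]; simp
  | succ d ih =>
    intro h hm y r hr hg p hp ε hε
    set κ := ENNReal.ofReal (C * ε ^ α)
    set N := ENNReal.ofReal (2 * r) with hN
    have mem : ∀ (u : ℝ) (v : Fin d → ℝ), (Fin.cons u v : Fin (d+1) → ℝ) ∈ Metric.ball y r ↔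
        u ∈ Metric.ball (y 0) r ∧ v ∈ Metric.ball (Fin.tail y) r := by
      intro u v
      simp only [Metric.mem_ball, dist_pi_lt_iff hr, Fin.forall_fin_succ, Fin.cons_zero,
        Fin.cons_succ, Fin.tail]
    have hvol : ∀ v : Fin d → ℝ, volume (Metric.ball v r) = N ^ d := by
      intro v
      rw [Real.volume_pi_ball v hr, Fintype.card_fin, hN, ENNReal.ofReal_pow (by positivity)]
    obtain ⟨p0, p', rfl⟩ : ∃ p0 p', p = (Fin.cons p0 p' : Fin (d+1) → ℝ) :=
      ⟨p 0, Fin.tail p, (Fin.cons_self_tail p).symm⟩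
    have hp' := (mem _ _).1 hp
    have hcm : Measurable (fun q : ℝ × (Fin d → ℝ) => (Fin.cons q.1 q.2 : Fin (d+1) → ℝ)) := by
      rw [measurable_pi_iff]
      intro i
      refine Fin.cases ?_ (fun j => ?_) i
      · simpa using measurable_fst
      · simp only [Fin.cons_succ]; exact (measurable_pi_apply j).comp measurable_snd
    have hmp : MeasurePreserving (MeasurableEquiv.piFinSuccAbove (fun _ : Fin (d+1) => ℝ) 0).symm :=
      (volume_preserving_piFinSuccAbove (fun _ : Fin (d+1) => ℝ) 0).symm
    rw [← hmp.measure_preimage_equiv]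
    set S1 : Set ℝ := {t ∈ Metric.ball (y 0) r | |h (Fin.cons t p')| < ε * |h (Fin.cons p0 p')|}
    set S2 : Set (ℝ × (Fin d → ℝ)) := {q | q.1 ∈ Metric.ball (y 0) r ∧
      q.2 ∈ Metric.ball (Fin.tail y) r ∧
        |h (Fin.cons q.1 q.2)| < ε ^ d * |h (Fin.cons q.1 p')|} with hS2
    have hsub : (MeasurableEquiv.piFinSuccAbove (fun _ : Fin (d+1) => ℝ) 0).symm ⁻¹'
        {x ∈ Metric.ball y r | |h x| < ε ^ (d+1) * |h (Fin.cons p0 p')|} ⊆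
        (S1 ×ˢ Metric.ball (Fin.tail y) r) ∪ S2 := by
      rintro ⟨u, v⟩ huv
      have huv' : (Fin.cons u v : Fin (d+1) → ℝ) ∈ Metric.ball y r ∧
        |h (Fin.cons u v)| < ε ^ (d+1) * |h (Fin.cons p0 p')| := by
        simpa [MeasurableEquiv.piFinSuccAbove, Fin.insertNthEquiv, Fin.insertNth_zero] using huv
      obtain ⟨h1, h2⟩ := huv'
      rw [mem] at h1
      by_cases hc : |h (Fin.cons u p')| < ε * |h (Fin.cons p0 p')|
      · left; exact ⟨⟨h1.1, hc⟩, h1.2⟩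
      · right
        refine ⟨h1.1, h1.2, h2.trans_le ?_⟩
        rw [pow_succ, mul_assoc]
        exact mul_le_mul_of_nonneg_left (not_lt.1 hc) (by positivity)
    refine (measure_mono hsub).trans ((measure_union_le _ _).trans ?_)
    have b1 : volume (S1 ×ˢ Metric.ball (Fin.tail y) r) ≤ κ * N ^ (d+1) := by
      rw [Measure.volume_eq_prod, Measure.prod_prod, hvol, pow_succ', ← mul_assoc]
      gcongr
      have := hg _ hp 0 ε hε
      simpa [S1] using this
    have hmS2 : MeasurableSet S2 := by
      have m1 : Measurable (fun q : ℝ × (Fin d → ℝ) => |h (Fin.cons q.1 q.2)|) :=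
        (hm.comp hcm).abs
      have m2 : Measurable (fun q : ℝ × (Fin d → ℝ) => ε ^ d * |h (Fin.cons q.1 p')|) :=
        ((hm.comp (hcm.comp (measurable_fst.prodMk measurable_const))).abs).const_mul _
      exact (measurable_fst Metric.isOpen_ball.measurableSet).inter
        ((measurable_snd Metric.isOpen_ball.measurableSet).inter (measurableSet_lt m1 m2))
    have b2 : volume S2 ≤ d * (κ * N ^ (d+1)) := by
      rw [Measure.volume_eq_prod, Measure.prod_apply hmS2]
      have hpt : ∀ u, volume (Prod.mk u ⁻¹' S2) ≤
          (Metric.ball (y 0) r).indicator (fun _ => d * (κ * N ^ d)) u := by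
        intro u
        by_cases hu : u ∈ Metric.ball (y 0) r
        · rw [Set.indicator_of_mem hu]
          have := ih (fun v => h (Fin.cons u v))
            (hm.comp (hcm.comp (measurable_const.prodMk measurable_id))) (Fin.tail y) r hr
            (fun x hx i ε hε => by
              have := hg (Fin.cons u x) ((mem _ _).2 ⟨hu, hx⟩) i.succ ε hε
              simpa only [Fin.tail, Fin.cons_update] using this) p' hp'.2 ε hε
          refine le_trans (measure_mono ?_) this
          intro v hv
          exact hv.2
        · rw [Set.indicator_of_notMem hu]
          have : Prod.mk u ⁻¹' S2 = ∅ := by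
            ext v
            simp only [Set.mem_preimage, Set.mem_empty_iff_false, iff_false]
            exact fun hv => hu hv.1
          rw [this]; simp
      refine (lintegral_mono hpt).trans ?_
      rw [lintegral_indicator Metric.isOpen_ball.measurableSet, setLIntegral_const, Real.volume_ball,
        ← hN, pow_succ]
      apply le_of_eq; ring
    refine (add_le_add b1 b2).trans (le_of_eq ?_)
    push_cast; ring

lemma aux_good (d : ℕ) (hd : 1 ≤ d) (L : (Fin d → ℝ) ≃L[ℝ] (Fin d → ℝ)) (k : ℕ) (K : ℝ)
    (hK : 0 < K) : ∃ C : ℝ, 1 ≤ C ∧ ∃ α : ℝ, 0 < α ∧ ∃ Λ : ℝ, 0 < Λ ∧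
      ∀ (W : Set (Fin d → ℝ)) (_ : IsOpen W) (g : (Fin d → ℝ) → ℝ) (_ : ContinuousOn g W)
        (Φ : Fin d → ℕ → (Fin d → ℝ) → ℝ) (A : ℝ) (_ : 0 < A) (_ : ∀ i x, Φ i 0 x = g x)
        (_ : ∀ i, ∀ j < k, ∀ x ∈ W,
          HasDerivAt (fun t : ℝ => Φ i j (x + t • L (Pi.single i 1))) (Φ i (j+1) x) 0)
        (_ : ∀ i, ∀ x ∈ W, A ≤ |Φ i k x|) (_ : ∀ i, ∀ x ∈ W, |Φ i k x| ≤ K * A)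
        (x : Fin d → ℝ) (r : ℝ) (_ : 0 < r) (_ : Metric.ball x (Λ * r) ⊆ W) (ε : ℝ) (_ : 0 < ε),
        volume {y ∈ Metric.ball x r | |g y| < ε * ⨆ w ∈ Metric.ball x r, |g w|} ≤
          ENNReal.ofReal (C * ε ^ α) * volume (Metric.ball x r) := by
  set C1 : ℝ := (2 * (k + 1)) ^ k * ((K + 1) * (k + 1)) + 1 with hC1
  have hC1pos : 0 < C1 := by positivity
  set β : ℝ := 1 / ((k : ℝ) + 1) with hβ
  have hβpos : 0 < β := by positivity
  have hdpos : (0:ℝ) < d := by exact_mod_cast hd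
  set l : ℝ := ‖(L.symm : (Fin d → ℝ) →L[ℝ] (Fin d → ℝ))‖ + 1 with hl
  set m : ℝ := ‖(L : (Fin d → ℝ) →L[ℝ] (Fin d → ℝ))‖ + 1 with hm
  have hlpos : 0 < l := by positivity
  have hmpos : 0 < m := by positivity
  set Δ : ℝ := |(L : (Fin d → ℝ) →L[ℝ] (Fin d → ℝ)).det| with hΔ
  refine ⟨max 1 (Δ * (d * (C1 * 2 ^ (β / d) * l ^ d))), le_max_left _ _, β / d, by positivity,
    m * l, by positivity, ?_⟩
  intro W hW g hg Φ A hA hΦ0 hΦ hlo hhi x r hr hball ε hε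
  set s := ⨆ w ∈ Metric.ball x r, |g w| with hs
  by_cases hs0 : s ≤ 0
  · have : {y ∈ Metric.ball x r | |g y| < ε * s} = ∅ := by
      ext y
      simp only [Set.mem_setOf_eq, Set.mem_empty_iff_false, iff_false, not_and, not_lt]
      intro _
      have := abs_nonneg (g y)
      nlinarith
    rw [this]; simp
  rw [not_le] at hs0
  obtain ⟨p, hp, hps⟩ : ∃ p ∈ Metric.ball x r, s < 2 * |g p| := by
    by_contra hcon
    push Not at hcon
    have : s ≤ s / 2 := by
      refine Real.iSup_le (fun w => Real.iSup_le (fun hw => ?_) (by positivity)) (by positivity)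
      linarith [hcon w hw]
    linarith
  have hLs : ∀ z z' : Fin d → ℝ, dist (L z) (L z') ≤ m * dist z z' := by
    intro z z'
    rw [dist_eq_norm, dist_eq_norm, ← map_sub]
    refine ((L : (Fin d → ℝ) →L[ℝ] (Fin d → ℝ)).le_opNorm (z - z')).trans ?_
    apply mul_le_mul_of_nonneg_right _ (norm_nonneg _)
    rw [hm]; linarith
  have hLsy : ∀ z z' : Fin d → ℝ, dist (L.symm z) (L.symm z') ≤ l * dist z z' := by
    intro z z'
    rw [dist_eq_norm, dist_eq_norm, ← map_sub]
    refine ((L.symm : (Fin d → ℝ) →L[ℝ] (Fin d → ℝ)).le_opNorm (z - z')).trans ?_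
    apply mul_le_mul_of_nonneg_right _ (norm_nonneg _)
    rw [hl]; linarith
  have hin : ∀ z ∈ Metric.ball (L.symm x) (l * r), L z ∈ W := by
    intro z hz
    apply hball
    have := hLs z (L.symm x)
    rw [L.apply_symm_apply] at this
    rw [Metric.mem_ball] at hz ⊢
    calc dist (L z) x ≤ m * dist z (L.symm x) := this
      _ < m * (l * r) := mul_lt_mul_of_pos_left hz hmpos
      _ = m * l * r := by ring
  have hin' : ∀ z ∈ Metric.ball x r, L.symm z ∈ Metric.ball (L.symm x) (l * r) := by
    intro z hz
    rw [Metric.mem_ball] at hz ⊢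
    exact (hLsy z x).trans_lt (mul_lt_mul_of_pos_left hz hlpos)
  classical
  set gW : (Fin d → ℝ) → ℝ := W.indicator g with hgW
  have hgWm : Measurable gW := by
    rw [hgW, ← Set.piecewise_eq_indicator]
    exact hg.measurable_piecewise continuousOn_const hW.measurableSet
  have hgWeq : ∀ z ∈ W, gW z = g z := fun z hz => Set.indicator_of_mem hz g
  set η : ℝ := (2 * ε) ^ (1 / (d : ℝ)) with hη
  have hηpos : 0 < η := by positivity
  have hηd : η ^ d = 2 * ε := by
    rw [hη, ← Real.rpow_natCast, ← Real.rpow_mul (by positivity), one_div,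
      inv_mul_cancel₀ hdpos.ne', Real.rpow_one]
  have key := aux_prod C1 β d (fun z => gW (L z)) (hgWm.comp L.continuous.measurable)
    (L.symm x) (l * r) (by positivity) (by
      intro z hz i ε' hε'
      have hup : ∀ t ∈ Metric.ball (L.symm x i) (l * r),
          Function.update z i t ∈ Metric.ball (L.symm x) (l * r) := by
        intro t ht
        rw [Metric.mem_ball, dist_pi_lt_iff (by positivity)] at hz ⊢
        intro j
        by_cases hj : j = i
        · subst hj; simpa using ht
        · rw [Function.update_of_ne hj]; exact hz j
      have hzi : z i ∈ Metric.ball (L.symm x i) (l * r) := by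
        rw [Metric.mem_ball, dist_pi_lt_iff (by positivity)] at hz
        exact hz i
      have hballI : Metric.ball (L.symm x i) (l * r) =
        Set.Ioo (L.symm x i - l * r) (L.symm x i + l * r) := Real.ball_eq_Ioo _ _
      have h1 := aux_1d k K hK (L.symm x i - l * r) (L.symm x i + l * r)
        (by nlinarith [mul_pos hlpos hr]) (fun j t => Φ i j (L (Function.update z i t)))
        (by
          intro j hj t ht
          rw [← hballI] at ht
          have h2 := hΦ i j hj _ (hin _ (hup t ht))
          have h3 : HasDerivAt (fun u : ℝ => Φ i j (L (Function.update z i t) +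
              (u - t) • L (Pi.single i 1))) (Φ i (j+1) (L (Function.update z i t))) t := by
            have h2' : HasDerivAt (fun t' : ℝ => Φ i j (L (Function.update z i t) +
              t' • L (Pi.single i 1))) (Φ i (j+1) (L (Function.update z i t))) (t - t) := by
              rw [sub_self]; exact h2
            exact h2'.comp_sub_const t t
          refine h3.congr_of_eventuallyEq (Filter.Eventually.of_forall fun u => ?_)
          simp only
          congr 1
          rw [← map_smul, ← map_add]
          congr 1
          ext a
          by_cases ha : a = i
          · subst ha; simp
          · simp [ha])
        A hA (fun t ht => hlo i _ (hin _ (hup t (hballI ▸ ht))))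
        (fun t ht => hhi i _ (hin _ (hup t (hballI ▸ ht)))) (z i) (hballI ▸ hzi) ε' hε'
      rw [← hballI, Real.volume_ball] at h1
      refine le_trans (measure_mono ?_) h1
      rintro t ⟨ht, ht2⟩
      refine ⟨ht, ?_⟩
      simp only [hΦ0, Function.update_eq_self]
      rw [hgWeq _ (hin _ (hup t ht)), hgWeq _ (hin _ hz)] at ht2
      exact ht2)
    (L.symm p) (hin' p hp) η hηpos
  rw [hηd, L.apply_symm_apply] at key
  set E' := {z ∈ Metric.ball (L.symm x) (l * r) | |gW (L z)| < 2 * ε * |gW p|} with hE'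
  have hsub : {y ∈ Metric.ball x r | |g y| < ε * s} ⊆
      (L : (Fin d → ℝ) →L[ℝ] (Fin d → ℝ)) '' E' := by
    rintro y ⟨hy, hy2⟩
    refine ⟨L.symm y, ⟨hin' y hy, ?_⟩, by simp⟩
    have hyW := hin _ (hin' y hy)
    have hpW := hin _ (hin' p hp)
    rw [L.apply_symm_apply] at hyW hpW ⊢
    rw [hgWeq _ hyW, hgWeq _ hpW]
    nlinarith
  refine (measure_mono hsub).trans ?_
  rw [Measure.addHaar_image_continuousLinearMap, Real.volume_pi_ball x hr, Fintype.card_fin]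
  refine (mul_le_mul_right key _).trans ?_
  rw [← ENNReal.ofReal_natCast d, ← ENNReal.ofReal_pow (by positivity),
    ← ENNReal.ofReal_mul (by positivity), ← ENNReal.ofReal_mul (by positivity),
    ← ENNReal.ofReal_mul (by positivity), ← ENNReal.ofReal_mul (by positivity)]
  apply ENNReal.ofReal_le_ofReal
  have hηβ : η ^ β = 2 ^ (β / d) * ε ^ (β / d) := by
    rw [hη, ← Real.rpow_mul (by positivity), ← Real.mul_rpow (by positivity) hε.le]
    congr 1; ring
  rw [hηβ]
  calc Δ * (d * (C1 * (2 ^ (β / d) * ε ^ (β / d)) * (2 * (l * r)) ^ d))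
      = (Δ * (d * (C1 * 2 ^ (β / d) * l ^ d))) * ε ^ (β / d) * (2 * r) ^ d := by
        rw [show 2 * (l * r) = l * (2 * r) by ring, mul_pow]; ring
    _ ≤ _ := by gcongr; exact le_max_right _ _

lemma aux_basis (d : ℕ) (O : Set (Fin d → ℝ)) (hO : IsOpen O) (v0 : Fin d → ℝ) (hv : v0 ∈ O) :
    ∃ L : (Fin d → ℝ) ≃L[ℝ] (Fin d → ℝ), ∀ i, L (Pi.single i 1) ∈ O := by
  set M0 : Matrix (Fin d) (Fin d) ℝ := Matrix.of fun a _ => - v0 a with hM0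
  have h1 : ∀ᶠ t : ℝ in nhdsWithin 0 {0}ᶜ, (Matrix.scalar (Fin d) t - M0).det ≠ 0 := by
    have hfin : Set.Finite {t : ℝ | M0.charpoly.IsRoot t} :=
      Polynomial.finite_setOf_isRoot (M0.charpoly_monic.ne_zero)
    have := nhdsNE_le_cofinite (0:ℝ) hfin.compl_mem_cofinite
    filter_upwards [this] with t ht h0
    apply ht
    simp only [Set.mem_setOf_eq, Polynomial.IsRoot, Matrix.eval_charpoly]
    exact h0
  have h2 : ∀ᶠ t : ℝ in nhdsWithin 0 {0}ᶜ, ∀ i, v0 + t • (Pi.single i (1:ℝ) : Fin d → ℝ) ∈ O := by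
    apply Filter.Eventually.filter_mono nhdsWithin_le_nhds
    rw [Filter.eventually_all]
    intro i
    have hc : ContinuousAt (fun t : ℝ => v0 + t • (Pi.single i (1:ℝ) : Fin d → ℝ)) 0 := by fun_prop
    apply hc
    apply hO.mem_nhds
    simpa using hv
  obtain ⟨t, ht1, ht2⟩ := (h1.and h2).exists
  have hdet : LinearMap.det (Matrix.toLin' (Matrix.scalar (Fin d) t - M0)) ≠ 0 := by
    rw [LinearMap.det_toLin']; exact ht1
  refine ⟨(LinearMap.equivOfDetNeZero _ hdet).toContinuousLinearEquiv, fun i => ?_⟩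
  have : (LinearMap.equivOfDetNeZero _ hdet).toContinuousLinearEquiv (Pi.single i 1) =
      v0 + t • (Pi.single i (1:ℝ) : Fin d → ℝ) := by
    change (Matrix.toLin' (Matrix.scalar (Fin d) t - M0)) (Pi.single i 1) = _
    rw [Matrix.toLin'_apply]
    ext a
    simp [hM0, Matrix.sub_mulVec, Matrix.diagonal_apply, Pi.single_apply]
    by_cases h : a = i <;> simp [h, add_comm]
  rw [this]
  exact ht2 i

lemma aux_local (d : ℕ) (hd : 1 ≤ d) {P : Type} [NormedAddCommGroup P] [NormedSpace ℝ P]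
    (G : P × (Fin d → ℝ) → ℝ) (U : Set (Fin d → ℝ)) (hU : IsOpen U)
    (hG : AnalyticOnNhd ℝ G (Set.univ ×ˢ U)) (c0 : P) (x0 : Fin d → ℝ) (hx0 : x0 ∈ U)
    (hne : ¬ ∀ᶠ x in nhds x0, G (c0, x) = 0) :
    ∃ S ∈ nhds c0, ∃ V ∈ nhds x0, ∃ C : ℝ, 1 ≤ C ∧ ∃ α : ℝ, 0 < α ∧
      ∀ c ∈ S, IsGood C α V (fun x => G (c, x)) := by
  obtain ⟨k, v0, hkv⟩ : ∃ (k : ℕ) (v : Fin d → ℝ),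
      iteratedFDeriv ℝ k G (c0, x0) (fun _ => ((0 : P), v)) ≠ 0 := by
    by_contra hcon
    push Not at hcon
    apply hne
    obtain ⟨p, R, hp⟩ := hG (c0, x0) ⟨trivial, hx0⟩
    have hmem : ∀ᶠ x in nhds x0, ((0 : P), x - x0) ∈ Metric.eball (0 : P × (Fin d → ℝ)) R := by
      have hc : ContinuousAt (fun x : Fin d → ℝ => ((0 : P), x - x0)) x0 := by fun_prop
      apply hc
      simp only [sub_self]
      exact Metric.eball_mem_nhds _ hp.r_pos
    filter_upwards [hmem] with x hx
    have hs := hp.hasSum_iteratedFDeriv hx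
    simp only [hcon, smul_zero] at hs
    have := hs.unique hasSum_zero
    simpa using this
  set D : (Fin d → ℝ) → P × (Fin d → ℝ) → ℝ :=
    fun v z => iteratedFDeriv ℝ k G z (fun _ => ((0 : P), v)) with hD
  have hOo : IsOpen {v : Fin d → ℝ | D v (c0, x0) ≠ 0} := by
    have : Continuous (fun v => D v (c0, x0)) := by
      simp only [hD]
      exact (iteratedFDeriv ℝ k G (c0, x0)).cont.comp (by fun_prop)
    exact isOpen_ne_fun this continuous_const
  obtain ⟨L, hL⟩ := aux_basis d _ hOo v0 hkv
  have hpos : ∀ i, 0 < |D (L (Pi.single i 1)) (c0, x0)| := fun i => abs_pos.2 (hL i)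
  obtain ⟨A, hA, hApos⟩ : ∃ A : ℝ, (∀ i, A < |D (L (Pi.single i 1)) (c0, x0)|) ∧ 0 < A := by
    have h1 : ∀ᶠ A : ℝ in nhdsWithin 0 (Set.Ioi 0), ∀ i, A < |D (L (Pi.single i 1)) (c0, x0)| := by
      rw [Filter.eventually_all]
      intro i
      exact Filter.Eventually.filter_mono nhdsWithin_le_nhds (eventually_lt_nhds (hpos i))
    have h2 : ∀ᶠ A : ℝ in nhdsWithin 0 (Set.Ioi 0), 0 < A := self_mem_nhdsWithin
    exact (h1.and h2).exists
  obtain ⟨B, hB, hBpos⟩ : ∃ B : ℝ, (∀ i, |D (L (Pi.single i 1)) (c0, x0)| < B) ∧ 0 < B := by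
    have h1 : ∀ᶠ B : ℝ in Filter.atTop, ∀ i, |D (L (Pi.single i 1)) (c0, x0)| < B := by
      rw [Filter.eventually_all]
      intro i
      exact Filter.eventually_gt_atTop _
    exact (h1.and (Filter.eventually_gt_atTop 0)).exists
  obtain ⟨C, hC, α, hα, Λ, hΛ, hmain⟩ := aux_good d hd L k (B / A) (by positivity)
  have hcd : ∀ z ∈ (Set.univ ×ˢ U : Set (P × (Fin d → ℝ))), ∀ j : ℕ,
      DifferentiableAt ℝ (iteratedFDeriv ℝ j G) z := by
    intro z hz j
    have : ContDiffAt ℝ (j + 1 : ℕ) G z := (hG z hz).contDiffAt.of_le le_top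
    exact this.differentiableAt_iteratedFDeriv (by exact_mod_cast Nat.lt_succ_self j)
  have hev : ∀ᶠ z in nhds (c0, x0), z ∈ (Set.univ ×ˢ U : Set (P × (Fin d → ℝ))) ∧
      ∀ i, A < |D (L (Pi.single i 1)) z| ∧ |D (L (Pi.single i 1)) z| < B := by
    refine Filter.Eventually.and ((isOpen_univ.prod hU).mem_nhds ⟨trivial, hx0⟩) ?_
    rw [Filter.eventually_all]
    intro i
    have hc : ContinuousAt (fun z => |D (L (Pi.single i 1)) z|) (c0, x0) := by
      have h1 := (hcd (c0, x0) ⟨trivial, hx0⟩ k).continuousAt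
      have h2 : ContinuousAt (fun z => D (L (Pi.single i 1)) z) (c0, x0) :=
        (ContinuousMultilinearMap.apply ℝ (fun _ : Fin k => P × (Fin d → ℝ)) ℝ
          (fun _ => ((0 : P), L (Pi.single i 1)))).continuous.continuousAt.comp h1
      exact h2.abs
    exact (hc.eventually (eventually_gt_nhds (hA i))).and (hc.eventually (eventually_lt_nhds (hB i)))
  obtain ⟨S, hS, W0, hW0, hSW⟩ := mem_nhds_prod_iff.1 hev
  obtain ⟨τ, hτ, hτW⟩ := Metric.mem_nhds_iff.1 hW0
  set ρ := τ / (1 + 2 * Λ) with hρ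
  have hρpos : 0 < ρ := by positivity
  refine ⟨S, hS, Metric.ball x0 ρ, Metric.ball_mem_nhds _ hρpos, C, hC, α, hα, ?_⟩
  intro c hc x r hxr ε hε
  by_cases hr : r ≤ 0
  · simp [Metric.ball_eq_empty.2 hr]
  rw [not_le] at hr
  have hin : ∀ x ∈ Metric.ball x0 τ, ((c, x) ∈ (Set.univ ×ˢ U : Set (P × (Fin d → ℝ))) ∧
      ∀ i, A < |D (L (Pi.single i 1)) (c, x)| ∧ |D (L (Pi.single i 1)) (c, x)| < B) := by
    intro x hx
    exact hSW ⟨hc, hτW hx⟩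
  have hxx : dist x x0 < ρ := hxr (Metric.mem_ball_self hr)
  have hr2 : r ≤ 2 * ρ := by
    by_contra hcon
    rw [not_le] at hcon
    have : (x + fun _ => 2 * ρ) ∈ Metric.ball x r := by
      rw [Metric.mem_ball, dist_pi_lt_iff hr]
      intro i
      simp [abs_of_pos hρpos, hcon]
    have h1 := hxr this
    rw [Metric.mem_ball, dist_pi_lt_iff hρpos] at h1 
    rw [dist_pi_lt_iff hρpos] at hxx
    have h2 := h1 ⟨0, hd⟩
    have h3 := hxx ⟨0, hd⟩
    simp only [Real.dist_eq, abs_lt, Pi.add_apply] at h2 h3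
    linarith [h2.2, h3.1]
  refine hmain (Metric.ball x0 τ) Metric.isOpen_ball (fun x => G (c, x)) ?_
    (fun i j x => iteratedFDeriv ℝ j G (c, x) (fun _ => ((0 : P), L (Pi.single i 1))))
    A hApos ?_ ?_ ?_ ?_ x r hr ?_ ε hε
  · intro x hx
    have := (hG (c, x) (hin x hx).1).continuousAt
    exact (this.comp (f := fun x => (c, x)) (by fun_prop)).continuousWithinAt
  · intro i x
    exact iteratedFDeriv_zero_apply (𝕜 := ℝ) (f := G) _
  · intro i j hj x hx
    have h1 := (hcd (c, x) (hin x hx).1 j).hasFDerivAt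
    have h2 := (ContinuousMultilinearMap.apply ℝ (fun _ : Fin j => P × (Fin d → ℝ)) ℝ
          (fun _ => ((0 : P), L (Pi.single i 1)))).hasFDerivAt.comp (c, x) h1
    have h3 : HasDerivAt (fun t : ℝ => (c, x + t • L (Pi.single i 1)))
        ((0 : P), L (Pi.single i 1)) 0 := by
      have h4 : HasDerivAt (fun t : ℝ => x + t • L (Pi.single i 1)) (L (Pi.single i 1)) 0 := by
        simpa using ((hasDerivAt_id (0:ℝ)).smul_const (L (Pi.single i 1))).const_add x
      exact (hasDerivAt_const (0:ℝ) c).prodMk h4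
    have h6 := h2.comp_hasDerivAt_of_eq 0 h3 (by simp)
    refine h6.congr_deriv ?_
    rw [iteratedFDeriv_succ_apply_left]
    rfl
  · intro i x hx
    exact ((hin x hx).2 i).1.le
  · intro i x hx
    rw [div_mul_cancel₀ _ hApos.ne']
    exact ((hin x hx).2 i).2.le
  · apply Metric.ball_subset_ball'
    have : ρ * (1 + 2 * Λ) = τ := by rw [hρ]; field_simp
    nlinarith

lemma IsGood.weaken {d : ℕ} {C C' α α' : ℝ} {V V' : Set (Fin d → ℝ)} {g : (Fin d → ℝ) → ℝ}
    (h : IsGood C α V g) (hC1 : 1 ≤ C) (hC : C ≤ C') (hα' : 0 < α') (hα : α' ≤ α) (hV : V' ⊆ V) :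
    IsGood C' α' V' g := by
  intro x r hb ε hε
  by_cases h1 : ε ≤ 1
  · refine (h x r (hb.trans hV) ε hε).trans ?_
    gcongr ?_ * _
    apply ENNReal.ofReal_le_ofReal
    have := Real.rpow_le_rpow_of_exponent_ge hε h1 hα
    have hC0 : 0 ≤ C' := by linarith
    gcongr
  · rw [not_le] at h1
    refine (measure_mono (fun y hy => hy.1)).trans ?_
    nth_rewrite 1 [← one_mul (volume (Metric.ball x r))]
    gcongr
    rw [← ENNReal.ofReal_one]
    apply ENNReal.ofReal_le_ofReal
    have := Real.one_le_rpow h1.le hα'.le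
    nlinarith

lemma IsGood.congr_on {d : ℕ} {C α : ℝ} {V : Set (Fin d → ℝ)} {g g' : (Fin d → ℝ) → ℝ}
    (h : IsGood C α V g) (hg : ∀ x ∈ V, g' x = g x) : IsGood C α V g' := by
  intro x r hb ε hε
  have h1 : (⨆ w ∈ Metric.ball x r, |g' w|) = ⨆ w ∈ Metric.ball x r, |g w| := by
    congr 1; ext w; congr 1; ext hw; rw [hg w (hb hw)]
  rw [h1]
  refine le_trans (measure_mono ?_) (h x r hb ε hε)
  rintro y ⟨hy, hy2⟩
  exact ⟨hy, by rwa [hg y (hb hy)] at hy2⟩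

lemma IsGood.mul_const {d : ℕ} {C α : ℝ} {V : Set (Fin d → ℝ)} {g : (Fin d → ℝ) → ℝ}
    (h : IsGood C α V g) (a : ℝ) : IsGood C α V (fun x => a * g x) := by
  intro x r hb ε hε
  have h1 : (⨆ w ∈ Metric.ball x r, |a * g w|) = |a| * ⨆ w ∈ Metric.ball x r, |g w| := by
    rw [Real.mul_iSup_of_nonneg (abs_nonneg a)]
    congr 1; ext w
    rw [Real.mul_iSup_of_nonneg (abs_nonneg a)]
    congr 1; ext hw; rw [abs_mul]
  rw [h1]
  refine le_trans (measure_mono ?_) (h x r hb ε hε)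
  rintro y ⟨hy, hy2⟩
  refine ⟨hy, ?_⟩
  rw [abs_mul, mul_left_comm] at hy2
  exact lt_of_mul_lt_mul_left hy2 (abs_nonneg a)

lemma isGood_zero {d : ℕ} (C α : ℝ) (V : Set (Fin d → ℝ)) : IsGood C α V (fun _ => 0) := by
  intro x r hb ε hε
  simp

theorem good_linear_combinations_real_analytic (d n : ℕ) (hd : 1 ≤ d) (hn : 1 ≤ n)
    (U : Set (Fin d → ℝ)) (hUo : IsOpen U) (hUc : IsConnected U)
    (f : (Fin d → ℝ) → (Fin n → ℝ)) (hf : AnalyticOnNhd ℝ f U) :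
    ∀ x₀ ∈ U, ∃ V ∈ nhds x₀, V ⊆ U ∧ ∃ C : ℝ, 0 < C ∧ ∃ α : ℝ, 0 < α ∧
      ∀ c : Fin (n + 1) → ℝ,
        IsGood C α V (fun x => c 0 + ∑ i, c i.succ * f x i) := by
  intro x₀ hx₀
  set G : (Fin (n+1) → ℝ) × (Fin d → ℝ) → ℝ :=
    fun z => z.1 0 + ∑ i, z.1 i.succ * f z.2 i with hGdef
  have hG : AnalyticOnNhd ℝ G (Set.univ ×ˢ U) := by
    intro z hz
    have hc : ∀ j, AnalyticAt ℝ (fun z : (Fin (n+1) → ℝ) × (Fin d → ℝ) => z.1 j) z := fun j =>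
      ((ContinuousLinearMap.proj (R := ℝ) (φ := fun _ : Fin (n+1) => ℝ) j).comp
        (ContinuousLinearMap.fst ℝ (Fin (n+1) → ℝ) (Fin d → ℝ))).analyticAt z
    have hff : ∀ i, AnalyticAt ℝ (fun z : (Fin (n+1) → ℝ) × (Fin d → ℝ) => f z.2 i) z := by
      intro i
      have h1 : AnalyticAt ℝ (fun z : (Fin (n+1) → ℝ) × (Fin d → ℝ) => f z.2) z :=
        (hf z.2 hz.2).comp analyticAt_snd
      exact ((ContinuousLinearMap.proj (R := ℝ) (φ := fun _ : Fin n => ℝ) i).analyticAt _).comp h1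
    exact (hc 0).add (Finset.analyticAt_fun_sum _ (fun i _ => (hc i.succ).mul (hff i)))
  have hadd : ∀ c c' x, G (c + c', x) = G (c, x) + G (c', x) := by
    intro c c' x
    simp only [hGdef, Pi.add_apply, add_mul, Finset.sum_add_distrib]; ring
  have hsmul : ∀ (a : ℝ) c x, G (a • c, x) = a * G (c, x) := by
    intro a c x
    simp only [hGdef, Pi.smul_apply, smul_eq_mul, mul_add, Finset.mul_sum, mul_assoc]
  let N : Submodule ℝ (Fin (n+1) → ℝ) :=
    { carrier := {c | ∀ x ∈ U, G (c, x) = 0}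
      add_mem' := fun {a b} ha hb x hx => by rw [hadd, ha x hx, hb x hx, add_zero]
      zero_mem' := fun x hx => by simp [hGdef]
      smul_mem' := fun a c hc x hx => by rw [hsmul, hc x hx, mul_zero] }
  obtain ⟨M, hM⟩ := N.exists_isCompl
  have hK : IsCompact ((M : Set (Fin (n+1) → ℝ)) ∩ Metric.sphere 0 1) :=
    (isCompact_sphere _ _).inter_left M.closed_of_finiteDimensional
  obtain ⟨V, hV, C, hC, α, hα, hgood⟩ : ∃ V ∈ nhds x₀, ∃ C : ℝ, 1 ≤ C ∧ ∃ α : ℝ, 0 < α ∧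
      ∀ c ∈ (M : Set (Fin (n+1) → ℝ)) ∩ Metric.sphere 0 1, IsGood C α V (fun x => G (c, x)) := by
    refine hK.induction_on (p := fun S => ∃ V ∈ nhds x₀, ∃ C : ℝ, 1 ≤ C ∧ ∃ α : ℝ, 0 < α ∧
      ∀ c ∈ S, IsGood C α V (fun x => G (c, x))) ?_ ?_ ?_ ?_
    · exact ⟨Set.univ, Filter.univ_mem, 1, le_rfl, 1, one_pos, by simp⟩
    · rintro s t hst ⟨V, hV, C, hC, α, hα, h⟩
      exact ⟨V, hV, C, hC, α, hα, fun c hc => h c (hst hc)⟩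
    · rintro s t ⟨V, hV, C, hC, α, hα, h⟩ ⟨V', hV', C', hC', α', hα', h'⟩
      refine ⟨V ∩ V', Filter.inter_mem hV hV', max C C', le_max_of_le_left hC, min α α',
        lt_min hα hα', ?_⟩
      rintro c (hc | hc)
      · exact (h c hc).weaken hC (le_max_left _ _) (lt_min hα hα') (min_le_left _ _)
          Set.inter_subset_left
      · exact (h' c hc).weaken hC' (le_max_right _ _) (lt_min hα hα') (min_le_right _ _)
          Set.inter_subset_right
    · rintro c ⟨hcM, hc1⟩
      have hne : ¬ ∀ᶠ x in nhds x₀, G (c, x) = 0 := by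
        intro h0
        have han : AnalyticOnNhd ℝ (fun x => G (c, x)) U := fun x hx =>
          (hG (c, x) ⟨trivial, hx⟩).comp (f := fun x => (c, x))
            (analyticAt_const.prod analyticAt_id)
        have hz := han.eqOn_zero_of_preconnected_of_eventuallyEq_zero hUc.isPreconnected hx₀ h0
        have hcN : c ∈ N := fun x hx => hz hx
        have : c = 0 := by
          have := hM.disjoint.le_bot (show c ∈ N ⊓ M from ⟨hcN, hcM⟩)
          simpa using this
        rw [this] at hc1
        simp at hc1
      obtain ⟨S, hS, V, hV, C, hC, α, hα, h⟩ := aux_local d hd G U hUo hG c x₀ hx₀ hne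
      exact ⟨S, mem_nhdsWithin_of_mem_nhds hS, V, hV, C, hC, α, hα, h⟩
  refine ⟨V ∩ U, Filter.inter_mem hV (hUo.mem_nhds hx₀), Set.inter_subset_right, C, by linarith,
    α, hα, ?_⟩
  intro c
  change IsGood C α (V ∩ U) (fun x => G (c, x))
  have hc : c ∈ N ⊔ M := by rw [hM.sup_eq_top]; trivial
  obtain ⟨a, ha, b, hb, rfl⟩ := Submodule.mem_sup.1 hc
  have heq : ∀ x ∈ V ∩ U, G (a + b, x) = ‖b‖ * G (‖b‖⁻¹ • b, x) := by
    intro x hx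
    rw [hadd, ha x hx.2, zero_add, hsmul]
    by_cases hb0 : b = 0
    · simp [hb0, hGdef]
    · have : ‖b‖ ≠ 0 := norm_ne_zero_iff.2 hb0
      field_simp
  by_cases hb0 : b = 0
  · refine (isGood_zero C α (V ∩ U)).congr_on (fun x hx => ?_)
    rw [heq x hx, hb0]; simp
  · refine IsGood.congr_on (IsGood.mul_const ?_ ‖b‖) heq
    refine (hgood (‖b‖⁻¹ • b) ⟨M.smul_mem _ hb, ?_⟩).weaken hC le_rfl hα le_rfl
      Set.inter_subset_left
    rw [mem_sphere_zero_iff_norm, norm_smul, norm_inv, norm_norm,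
      inv_mul_cancel₀ (norm_ne_zero_iff.2 hb0)]
end

section
/- Let n ≥ 1, let U ⊆ ℂ be open, and let f : U → ℂⁿ be a holomorphic (complex analytic) map. Then for every z₀ ∈ U there exist an open ball B̃ ⊆ U centered at z₀ and constants C, α > 0 such that for every t ∈ [0,∞)ⁿ and every nonzero subgroup Γ of Λ, the function z ↦ ‖g_t u_{f(z)} Γ‖ is (C,α)-good on B̃ (identifying ℂ with ℝ²). -/
open MeasureTheory

/-- The covolume of the subgroup generated by the (linearly independent) family w:
the square root of the Gram determinant. -/
noncomputable def covol {m l : ℕ} (w : Fin l → (Fin m → ℝ)) : ℝ :=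
  Real.sqrt (Matrix.det (Matrix.of fun i j => ∑ a, w i a * w j a))

/-- f is (C,α)-good on V ⊆ ℂ ≅ ℝ². -/
def IsGoodC (C α : ℝ) (V : Set ℂ) (f : ℂ → ℝ) : Prop :=
  ∀ (x : ℂ) (r : ℝ), Metric.ball x r ⊆ V → ∀ ε : ℝ, 0 < ε →
    volume {y ∈ Metric.ball x r | |f y| < ε * ⨆ w ∈ Metric.ball x r, |f w|} ≤
      ENNReal.ofReal (C * ε ^ α) * volume (Metric.ball x r)

lemma rolle_gen (I : Set ℝ) (hI : I.OrdConnected) (n : ℕ) : ∀ (g : ℕ → ℝ → ℝ),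
    (∀ i < n, ∀ x ∈ I, HasDerivAt (g i) (g (i+1) x) x) →
    ∀ s : Finset ℝ, (∀ x ∈ s, x ∈ I) → s.card = n + 1 → (∀ x ∈ s, g 0 x = 0) →
    ∃ ξ ∈ I, g n ξ = 0 := by
  induction n with
  | zero =>
    intro g _ s hs hc h0
    obtain ⟨x, hx⟩ := Finset.card_pos.mp (by omega : 0 < s.card)
    exact ⟨x, hs x hx, h0 x hx⟩
  | succ n ih =>
    intro g hg s hs hc h0
    let e := s.orderEmbOfFin hc
    have he : ∀ i, e i ∈ s := fun i => s.orderEmbOfFin_mem hc i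
    have hlt : ∀ i : Fin (n+1), e i.castSucc < e i.succ := fun i =>
      e.strictMono (Fin.castSucc_lt_succ)
    have hsub : ∀ i : Fin (n+1), Set.Icc (e i.castSucc) (e i.succ) ⊆ I := fun i =>
      hI.out (hs _ (he _)) (hs _ (he _))
    have key : ∀ i : Fin (n+1), ∃ y ∈ Set.Ioo (e i.castSucc) (e i.succ), g 1 y = 0 := by
      intro i
      obtain ⟨c, hc, hc'⟩ := exists_hasDerivAt_eq_zero (f := g 0) (f' := g 1) (hlt i)
        (fun x hx => (hg 0 (by omega) x (hsub i hx)).continuousAt.continuousWithinAt)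
        (by rw [h0 _ (he _), h0 _ (he _)])
        (fun x hx => hg 0 (by omega) x (hsub i (Set.Ioo_subset_Icc_self hx)))
      exact ⟨c, hc, hc'⟩
    choose y hy hy0 using key
    have hmono : StrictMono y := by
      rw [Fin.strictMono_iff_lt_succ]
      intro i
      refine (hy _).2.trans (lt_of_eq_of_lt ?_ (hy _).1)
      rfl
    obtain ⟨ξ, h1, h2⟩ := ih (fun i => g (i+1)) (fun i hi x hx => hg (i+1) (by omega) x hx)
      (Finset.univ.image y) (by
        intro x hx
        simp only [Finset.mem_image, Finset.mem_univ, true_and] at hx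
        obtain ⟨i, rfl⟩ := hx
        exact hsub i (Set.Ioo_subset_Icc_self (hy i)))
      (by rw [Finset.card_image_of_injective _ hmono.injective]; simp)
      (by
        intro x hx
        simp only [Finset.mem_image, Finset.mem_univ, true_and] at hx
        obtain ⟨i, rfl⟩ := hx
        exact hy0 i)
    exact ⟨ξ, h1, h2⟩

lemma divided_diff (I : Set ℝ) (hI : I.OrdConnected) (n : ℕ) (g : ℕ → ℝ → ℝ)
    (hg : ∀ i < n, ∀ x ∈ I, HasDerivAt (g i) (g (i+1) x) x)
    (s : Finset ℝ) (hs : ∀ x ∈ s, x ∈ I) (hc : s.card = n + 1) :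
    ∃ ξ ∈ I, g n ξ = n.factorial * ∑ x ∈ s, g 0 x / ∏ y ∈ s.erase x, (x - y) := by
  have hinj : Set.InjOn (id : ℝ → ℝ) s := Function.injective_id.injOn
  set P := Lagrange.interpolate s id (g 0) with hP
  have hdeg : P.degree < s.card := Lagrange.degree_interpolate_lt _ hinj
  obtain ⟨ξ, h1, h2⟩ := rolle_gen I hI n
    (fun i x => g i x - ((Polynomial.derivative^[i]) P).eval x)
    (by
      intro i hi x hx
      have := (hg i hi x hx).sub (((Polynomial.derivative^[i]) P).hasDerivAt x)
      simpa [Function.iterate_succ_apply'] using! this)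
    s hs hc (by
      intro x hx
      have : P.eval (id x) = g 0 x := Lagrange.eval_interpolate_at_node _ hinj hx
      simp only [id] at this
      simp [this])
  refine ⟨ξ, h1, ?_⟩
  have h3 := Lagrange.eval_iterate_derivative_eq_sum hinj hdeg (k := n) (by omega) ξ
  have h4 : g n ξ = ((Polynomial.derivative^[n]) P).eval ξ := by simpa [sub_eq_zero] using h2
  rw [h4, h3]
  congr 1
  refine Finset.sum_congr rfl fun x hx => ?_
  have : P.eval (id x) = g 0 x := Lagrange.eval_interpolate_at_node _ hinj hx
  rw [this]
  simp [hc]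

/-- separated points give a bound -/
lemma divided_diff_bound (I : Set ℝ) (hI : I.OrdConnected) (n : ℕ) (g : ℕ → ℝ → ℝ)
    (hg : ∀ i < n, ∀ x ∈ I, HasDerivAt (g i) (g (i+1) x) x)
    (s : Finset ℝ) (hs : ∀ x ∈ s, x ∈ I) (hc : s.card = n + 1) (δ S : ℝ) (hδ : 0 < δ)
    (hsep : ∀ x ∈ s, ∀ y ∈ s, x ≠ y → δ ≤ |x - y|) (hS : ∀ x ∈ s, |g 0 x| ≤ S) :
    ∃ ξ ∈ I, |g n ξ| ≤ n.factorial * ((n + 1) * (S / δ ^ n)) := by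
  obtain ⟨ξ, h1, h2⟩ := divided_diff I hI n g hg s hs hc
  refine ⟨ξ, h1, ?_⟩
  rw [h2, abs_mul, Nat.abs_cast]
  gcongr
  refine (Finset.abs_sum_le_sum_abs _ _).trans ?_
  have : ∀ x ∈ s, |g 0 x / ∏ y ∈ s.erase x, (x - y)| ≤ S / δ ^ n := by
    intro x hx
    rw [abs_div, Finset.abs_prod]
    have h0 : 0 ≤ S := (abs_nonneg _).trans (hS x hx)
    have : δ ^ n ≤ ∏ y ∈ s.erase x, |x - y| := by
      have h5 : (s.erase x).card = n := by rw [Finset.card_erase_of_mem hx]; omega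
      rw [← h5, ← Finset.prod_const]
      refine Finset.prod_le_prod (fun _ _ => hδ.le) fun y hy => ?_
      exact hsep x hx y (Finset.mem_of_mem_erase hy) (Finset.ne_of_mem_erase hy).symm
    exact div_le_div₀ h0 (hS x hx) (by positivity) this
  refine (Finset.sum_le_sum this).trans ?_
  rw [Finset.sum_const, hc]
  simp

/-- the version used on segments: nodes are `0` and points in the small set -/
lemma divided_diff_small (n : ℕ) (g : ℕ → ℝ → ℝ) (R : ℝ) (I : Set ℝ)
    (hI : I.OrdConnected) (hI0 : (0:ℝ) ∈ I) (hIR : ∀ x ∈ I, |x| ≤ R)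
    (hg : ∀ i < n, ∀ x ∈ I, HasDerivAt (g i) (g (i+1) x) x)
    (s : Finset ℝ) (hs : ∀ x ∈ s, x ∈ I) (hc : s.card = n) (δ σ A : ℝ) (hδ : 0 < δ)
    (hsep : ∀ x ∈ s, ∀ y ∈ s, x ≠ y → δ ≤ |x - y|) (hs0 : ∀ x ∈ s, δ ≤ x)
    (hσ : ∀ x ∈ s, |g 0 x| ≤ σ) (hA : ∀ x ∈ I, |g n x| ≤ A) :
    |g 0 0| / R ^ n ≤ A + n * (σ / δ ^ n) := by
  have h0 : (0:ℝ) ∉ s := fun h => by linarith [hs0 0 h]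
  set s' := insert 0 s with hs'
  have hc' : s'.card = n + 1 := by rw [hs', Finset.card_insert_of_notMem h0, hc]
  have hsI : ∀ x ∈ s', x ∈ I := by
    intro x hx
    rcases Finset.mem_insert.mp hx with rfl | hx
    · exact hI0
    · exact hs x hx
  have hsep' : ∀ x ∈ s', ∀ y ∈ s', x ≠ y → δ ≤ |x - y| := by
    intro x hx y hy hxy
    rcases Finset.mem_insert.mp hx with rfl | hx
    · rcases Finset.mem_insert.mp hy with rfl | hy
      · exact absurd rfl hxy
      · simpa using (hs0 y hy).trans (le_abs_self y)
    · rcases Finset.mem_insert.mp hy with rfl | hy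
      · simpa using (hs0 x hx).trans (le_abs_self x)
      · exact hsep x hx y hy hxy
  obtain ⟨ξ, h1, h2⟩ := divided_diff I hI n g hg s' hsI hc'
  rw [hs', Finset.sum_insert h0, ← hs', Finset.erase_insert h0] at h2
  have hfac : (1:ℝ) ≤ n.factorial := by exact_mod_cast Nat.one_le_iff_ne_zero.mpr n.factorial_ne_zero
  have hA0 : 0 ≤ A := (abs_nonneg _).trans (hA ξ h1)
  have e1 : |∑ x ∈ s, g 0 x / ∏ y ∈ s'.erase x, (x - y)| ≤ n * (σ / δ ^ n) := by
    refine (Finset.abs_sum_le_sum_abs _ _).trans ?_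
    have : ∀ x ∈ s, |g 0 x / ∏ y ∈ s'.erase x, (x - y)| ≤ σ / δ ^ n := by
      intro x hx
      have hx' : x ∈ s' := Finset.mem_insert_of_mem hx
      rw [abs_div, Finset.abs_prod]
      have h0 : 0 ≤ σ := (abs_nonneg _).trans (hσ x hx)
      have : δ ^ n ≤ ∏ y ∈ s'.erase x, |x - y| := by
        have h5 : (s'.erase x).card = n := by rw [Finset.card_erase_of_mem hx']; omega
        rw [← h5, ← Finset.prod_const]
        refine Finset.prod_le_prod (fun _ _ => hδ.le) fun y hy => ?_
        exact hsep' x hx' y (Finset.mem_of_mem_erase hy) (Finset.ne_of_mem_erase hy).symm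
      exact div_le_div₀ h0 (hσ x hx) (by positivity) this
    refine (Finset.sum_le_sum this).trans ?_
    rw [Finset.sum_const, hc]
    simp
  have e2 : |g 0 0| / R ^ n ≤ |g 0 0 / ∏ y ∈ s, (0 - y)| := by
    rw [abs_div, Finset.abs_prod]
    refine div_le_div_of_nonneg_left (abs_nonneg _) ?_ ?_
    · refine Finset.prod_pos fun y hy => ?_
      have := hs0 y hy
      rw [abs_pos]; intro h; linarith
    · rw [← hc, ← Finset.prod_const]
      refine Finset.prod_le_prod (fun _ _ => abs_nonneg _) fun y hy => ?_
      simpa using hIR y (hs y hy)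
  have e3 : |g 0 0 / ∏ y ∈ s, (0 - y) + ∑ x ∈ s, g 0 x / ∏ y ∈ s'.erase x, (x - y)| ≤ A := by
    have h3 : |g n ξ| = n.factorial *
      |g 0 0 / ∏ y ∈ s, (0 - y) + ∑ x ∈ s, g 0 x / ∏ y ∈ s'.erase x, (x - y)| := by
      rw [h2, abs_mul, Nat.abs_cast]
    have := hA ξ h1
    nlinarith [abs_nonneg (g 0 0 / ∏ y ∈ s, (0 - y) + ∑ x ∈ s, g 0 x / ∏ y ∈ s'.erase x, (x - y))]
  have e4 := abs_sub_abs_le_abs_sub (g 0 0 / ∏ y ∈ s, (0 - y))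
    (-∑ x ∈ s, g 0 x / ∏ y ∈ s'.erase x, (x - y))
  rw [abs_neg, sub_neg_eq_add] at e4
  linarith

lemma exists_separated (δ : ℝ) (hδ : 0 < δ) (n : ℕ) : ∀ (E : Set ℝ) (a : ℝ),
    ENNReal.ofReal (2 * n * δ) < volume (E ∩ Set.Ici a) →
    ∃ s : Finset ℝ, (∀ x ∈ s, x ∈ E) ∧ s.card = n ∧ (∀ x ∈ s, a + δ ≤ x) ∧
      (∀ x ∈ s, ∀ y ∈ s, x ≠ y → δ ≤ |x - y|) := by
  induction n with
  | zero => intro E a _; exact ⟨∅, by simp⟩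
  | succ n ih =>
    intro E a h
    set E' := E ∩ Set.Ici (a + δ) with hE'
    have h1 : volume (E ∩ Set.Ici a) ≤ ENNReal.ofReal δ + volume E' := by
      have : E ∩ Set.Ici a ⊆ Set.Ico a (a + δ) ∪ E' := by
        rintro x ⟨hx, hxa⟩
        by_cases hh : x < a + δ
        · exact Or.inl ⟨hxa, hh⟩
        · exact Or.inr ⟨hx, not_lt.mp hh⟩
      refine (measure_mono this).trans ((measure_union_le _ _).trans ?_)
      simp
    have h2 : ENNReal.ofReal ((2 * n + 1) * δ) < volume E' := by
      have : ENNReal.ofReal (2 * (n+1:ℕ) * δ) = ENNReal.ofReal δ + ENNReal.ofReal ((2 * n + 1) * δ) := by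
        rw [← ENNReal.ofReal_add hδ.le (by positivity)]
        congr 1; push_cast; ring
      rw [this] at h
      exact lt_of_add_lt_add_left (h.trans_le h1)
    have hne : E'.Nonempty := by
      by_contra hcon
      rw [Set.not_nonempty_iff_eq_empty] at hcon
      simp [hcon] at h2
    have hbdd : BddBelow E' := ⟨a + δ, fun x hx => hx.2⟩
    obtain ⟨x0, hx0, hx0'⟩ := exists_lt_of_csInf_lt hne (show sInf E' < sInf E' + δ by linarith)
    have h3 : volume E' ≤ ENNReal.ofReal δ + volume (E ∩ Set.Ici x0) := by
      have : E' ⊆ Set.Ico (sInf E') (sInf E' + δ) ∪ (E ∩ Set.Ici x0) := by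
        intro x hx
        by_cases hh : x < x0
        · exact Or.inl ⟨csInf_le hbdd hx, by linarith⟩
        · exact Or.inr ⟨hx.1, not_lt.mp hh⟩
      refine (measure_mono this).trans ((measure_union_le _ _).trans ?_)
      simp
    have h4 : ENNReal.ofReal (2 * n * δ) < volume (E ∩ Set.Ici x0) := by
      have : ENNReal.ofReal ((2 * n + 1) * δ) = ENNReal.ofReal δ + ENNReal.ofReal (2 * n * δ) := by
        rw [← ENNReal.ofReal_add hδ.le (by positivity)]
        congr 1; ring
      rw [this] at h2
      exact lt_of_add_lt_add_left (h2.trans_le h3)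
    obtain ⟨s, hs1, hs2, hs3, hs4⟩ := ih E x0 h4
    have hxs : x0 ∉ s := fun hh => by linarith [hs3 x0 hh]
    refine ⟨insert x0 s, ?_, ?_, ?_, ?_⟩
    · intro x hx
      rcases Finset.mem_insert.mp hx with rfl | hx
      · exact hx0.1
      · exact hs1 x hx
    · rw [Finset.card_insert_of_notMem hxs, hs2]
    · intro x hx
      have h5 : a + δ ≤ x0 := hx0.2
      rcases Finset.mem_insert.mp hx with rfl | hx
      · exact h5
      · linarith [hs3 x hx]
    · intro x hx y hy hxy
      rcases Finset.mem_insert.mp hx with rfl | hx2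
      · rcases Finset.mem_insert.mp hy with rfl | hy2
        · exact absurd rfl hxy
        · rw [abs_sub_comm]; refine le_trans ?_ (le_abs_self _); linarith [hs3 y hy2]
      · rcases Finset.mem_insert.mp hy with rfl | hy2
        · refine le_trans ?_ (le_abs_self _); linarith [hs3 x hx2]
        · exact hs4 x hx2 y hy2 hxy

lemma seg_measure (n : ℕ) (hn : 1 ≤ n) (g : ℕ → ℝ → ℝ) (R : ℝ) (hR : 0 < R) (I : Set ℝ)
    (hI : I.OrdConnected) (hI0 : (0:ℝ) ∈ I) (hIR : ∀ x ∈ I, |x| ≤ R)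
    (hg : ∀ i < n, ∀ x ∈ I, HasDerivAt (g i) (g (i+1) x) x) (ε A : ℝ) (hε : 0 < ε)
    (hT : 0 < |g 0 0|) (hA : ∀ x ∈ I, |g n x| ≤ A) (hAT : A ≤ |g 0 0| / (2 * R ^ n)) :
    volume {x : ℝ | 0 < x ∧ x ∈ I ∧ |g 0 x| < ε * |g 0 0|} ≤
      ENNReal.ofReal (2 * n * (R * (4 * n * ε) ^ (1 / (n:ℝ)))) := by
  by_contra hcon
  push Not at hcon
  set T := |g 0 0| with hTdef
  have hn0 : (0:ℝ) < n := by exact_mod_cast hn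
  set δ := R * (4 * n * ε) ^ (1 / (n:ℝ)) with hδdef
  have hδ : 0 < δ := by positivity
  have hδn : δ ^ n = R ^ n * (4 * n * ε) := by
    rw [hδdef, mul_pow, one_div, Real.rpow_inv_natCast_pow (by positivity) (by omega)]
  obtain ⟨s, hs1, hs2, hs3, hs4⟩ := exists_separated δ hδ n
    {x : ℝ | 0 < x ∧ x ∈ I ∧ |g 0 x| < ε * T} 0 (by
      refine hcon.trans_le (measure_mono ?_)
      intro x hx
      exact ⟨hx, hx.1.le⟩)
  have := divided_diff_small n g R I hI hI0 hIR hg s (fun x hx => (hs1 x hx).2.1) hs2 δ (ε * T) A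
    hδ hs4 (fun x hx => by simpa using hs3 x hx) (fun x hx => (hs1 x hx).2.2.le) hA
  rw [← hTdef, hδn] at this
  have hRn : 0 < R ^ n := by positivity
  have e1 : n * (ε * T / (R ^ n * (4 * n * ε))) = (T / R ^ n) / 4 := by field_simp
  have e2 : T / (2 * R ^ n) = (T / R ^ n) / 2 := by field_simp
  have e3 : 0 < T / R ^ n := by positivity
  rw [e1] at this
  rw [e2] at hAT
  linarith

lemma polar_bound (E : Set ℂ) (hE : MeasurableSet E) (p : ℂ) (R : ℝ) (m : ENNReal)
    (hER : ∀ y ∈ E, ‖y - p‖ ≤ R)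
    (hm : ∀ θ : ℝ, volume {ρ : ℝ | 0 < ρ ∧ p + ρ * (Real.cos θ + Real.sin θ * Complex.I) ∈ E} ≤ m) :
    volume E ≤ ENNReal.ofReal R * (m * ENNReal.ofReal (2 * Real.pi)) := by
  have h1 : volume E = volume ((fun y => p + y) ⁻¹' E) := (measure_preimage_add volume p E).symm
  set E' := (fun y => p + y) ⁻¹' E with hE'
  have hE'm : MeasurableSet E' := hE.preimage (by fun_prop)
  rw [h1, ← lintegral_indicator_one hE'm, ← Complex.lintegral_comp_polarCoord_symm]
  set S : Set (ℝ × ℝ) := (Set.Ioi 0 ×ˢ Set.Ioo (-Real.pi) Real.pi) ∩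
    (fun q : ℝ × ℝ => p + q.1 * (Real.cos q.2 + Real.sin q.2 * Complex.I)) ⁻¹' E with hS
  have hSm : MeasurableSet S := by
    refine (measurableSet_Ioi.prod measurableSet_Ioo).inter (hE.preimage ?_)
    fun_prop
  have h2 : ∫⁻ q in polarCoord.target, ENNReal.ofReal q.1 •
      E'.indicator (1 : ℂ → ENNReal) (Complex.polarCoord.symm q) ≤
      ∫⁻ q, ENNReal.ofReal R * S.indicator 1 q := by
    rw [← lintegral_indicator polarCoord.open_target.measurableSet]
    refine lintegral_mono fun q => ?_
    by_cases hq : q ∈ polarCoord.target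
    · rw [Set.indicator_of_mem hq]
      by_cases hq2 : Complex.polarCoord.symm q ∈ E'
      · have hqS : q ∈ S := by
          refine ⟨hq, ?_⟩
          rw [hE', Set.mem_preimage, Complex.polarCoord_symm_apply] at hq2
          exact hq2
        rw [Set.indicator_of_mem hq2, Set.indicator_of_mem hqS]
        simp only [Pi.one_apply, smul_eq_mul, mul_one]
        refine ENNReal.ofReal_le_ofReal ?_
        have := hER _ hq2
        rw [add_sub_cancel_left, Complex.norm_polarCoord_symm] at this
        exact (le_abs_self _).trans this
      · rw [Set.indicator_of_notMem hq2]; simp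
    · rw [Set.indicator_of_notMem hq]; simp
  refine h2.trans ?_
  rw [lintegral_const_mul _ (measurable_one.indicator hSm), lintegral_indicator_one hSm]
  gcongr
  rw [Measure.volume_eq_prod, Measure.prod_apply_symm hSm]
  have h3 : ∀ θ : ℝ, volume ((fun x => (x, θ)) ⁻¹' S) ≤
      (Set.Ioo (-Real.pi) Real.pi).indicator (fun _ => m) θ := by
    intro θ
    by_cases hθ : θ ∈ Set.Ioo (-Real.pi) Real.pi
    · rw [Set.indicator_of_mem hθ]
      refine (measure_mono ?_).trans (hm θ)
      intro x hx
      exact ⟨hx.1.1, hx.2⟩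
    · rw [Set.indicator_of_notMem hθ]
      have : (fun x => (x, θ)) ⁻¹' S = ∅ := by
        ext x; simp only [Set.mem_preimage, Set.mem_empty_iff_false, iff_false]
        intro hx; exact hθ hx.1.2
      rw [this]; simp
  refine (lintegral_mono h3).trans ?_
  rw [lintegral_indicator_const measurableSet_Ioo, Real.volume_Ioo]
  gcongr
  linarith

/-- iterated directional derivative -/
noncomputable def dirD (j : ℕ) (F : ℂ → ℝ) (θ z : ℂ) : ℝ := iteratedFDeriv ℝ j F z (fun _ => θ)

lemma dirD_hasDerivAt (F : ℂ → ℝ) (B : Set ℂ) (hF : AnalyticOnNhd ℝ F B) (j : ℕ) (z θ : ℂ) (s : ℝ)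
    (h : z + s * θ ∈ B) :
    HasDerivAt (fun s : ℝ => dirD j F θ (z + s * θ)) (dirD (j+1) F θ (z + s * θ)) s := by
  have h1 : HasFDerivAt (iteratedFDeriv ℝ j F) (fderiv ℝ (iteratedFDeriv ℝ j F) (z + s * θ))
      (z + s * θ) := by
    have := (hF _ h).contDiffAt (n := ⊤)
    exact (this.differentiableAt_iteratedFDeriv (m := j) (by simp)).hasFDerivAt
  have h2 : HasDerivAt (fun s : ℝ => z + s * θ) θ s := by
    have := ((Complex.ofRealCLM.hasDerivAt (x := s)).mul_const θ).const_add z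
    simpa using! this
  have h3 := h1.comp_hasDerivAt s h2
  have h4 := ((ContinuousMultilinearMap.apply ℝ (fun _ : Fin j => ℂ) ℝ
    (fun _ => θ)).hasFDerivAt).comp_hasDerivAt s h3
  exact h4

lemma dirD_zero (F : ℂ → ℝ) (θ z : ℂ) : dirD 0 F θ z = F z := by simp [dirD]

lemma dirD_continuousAt (F : ℂ → ℝ) (z : ℂ) (hF : AnalyticAt ℝ F z) (j : ℕ) (θ : ℂ) :
    ContinuousAt (dirD j F θ) z := by
  have h1 : ContinuousAt (iteratedFDeriv ℝ j F) z :=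
    ((hF.contDiffAt (n := ⊤)).differentiableAt_iteratedFDeriv (m := j) (by simp)).continuousAt
  exact (ContinuousMultilinearMap.apply ℝ (fun _ : Fin j => ℂ) ℝ
    (fun _ => θ)).continuous.continuousAt.comp h1

/-- linear combination -/
noncomputable def lc {N : ℕ} (b : Fin N → ℂ → ℝ) (c : Fin N → ℝ) : ℂ → ℝ :=
  fun z => ∑ i, c i * b i z

lemma lc_analytic {N : ℕ} (b : Fin N → ℂ → ℝ) (c : Fin N → ℝ) (z : ℂ)
    (hb : ∀ i, AnalyticAt ℝ (b i) z) : AnalyticAt ℝ (lc b c) z := by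
  unfold lc
  have : ∀ i ∈ Finset.univ, AnalyticAt ℝ (fun z => c i * b i z) z :=
    fun i _ => analyticAt_const.mul (hb i)
  exact Finset.analyticAt_fun_sum _ this

lemma dirD_lc {N : ℕ} (b : Fin N → ℂ → ℝ) (c : Fin N → ℝ) (z : ℂ)
    (hb : ∀ i, AnalyticAt ℝ (b i) z) (j : ℕ) (θ : ℂ) :
    dirD j (lc b c) θ z = ∑ i, c i * dirD j (b i) θ z := by
  unfold dirD lc
  have hc : ∀ i, ContDiffAt ℝ j (b i) z := fun i => (hb i).contDiffAt
  rw [iteratedFDeriv_fun_sum_apply (fun i _ => contDiffAt_const.mul (hc i))]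
  rw [sum_apply]
  refine Finset.sum_congr rfl fun i _ => ?_
  have := iteratedFDeriv_const_smul_apply' (a := c i) (hc i)
  simp only [smul_eq_mul] at this
  rw [this]
  simp

lemma nondeg (F : ℂ → ℝ) (z0 : ℂ) (ρ0 : ℝ) (hρ0 : 0 < ρ0)
    (hF : AnalyticOnNhd ℝ F (Metric.ball z0 ρ0)) (hne : ∃ z ∈ Metric.ball z0 ρ0, F z ≠ 0) :
    ∃ (j : ℕ) (θ : ℂ), ‖θ‖ ≤ 1 ∧ dirD j F θ z0 ≠ 0 := by
  by_contra hcon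
  push Not at hcon
  have hall : ∀ j θ, dirD j F θ z0 = 0 := by
    intro j θ
    have hpos : 0 < 1 + ‖θ‖ := by positivity
    have h2 := hcon j (((1 + ‖θ‖)⁻¹ : ℝ) • θ) (by
      rw [norm_smul, Real.norm_eq_abs, abs_of_pos (by positivity), inv_mul_le_iff₀ hpos]
      linarith)
    unfold dirD at h2 ⊢
    rw [ContinuousMultilinearMap.map_smul_univ (iteratedFDeriv ℝ j F z0)
      (fun _ => (1 + ‖θ‖)⁻¹) (fun _ => θ)] at h2
    rcases smul_eq_zero.mp h2 with h | h
    · simp at h; exact absurd h.1 hpos.ne'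
    · exact h
  obtain ⟨q, R, hq⟩ := hF z0 (Metric.mem_ball_self hρ0)
  have hev : F =ᶠ[nhds z0] 0 := by
    have : Metric.eball z0 R ∈ nhds z0 := Metric.eball_mem_nhds _ hq.r_pos
    filter_upwards [this] with y hy
    have hy' : y - z0 ∈ Metric.eball (0:ℂ) R := by
      simpa [Metric.mem_eball, edist_eq_enorm_sub] using hy
    have h3 := hq.hasSum_iteratedFDeriv hy'
    have h4 : ∀ n : ℕ, (iteratedFDeriv ℝ n F z0 fun _ => y - z0) = 0 := fun n => hall n _
    simp only [h4, smul_zero, add_sub_cancel] at h3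
    exact h3.unique hasSum_zero
  obtain ⟨z, hz, hz0⟩ := hne
  exact hz0 (hF.eqOn_zero_of_preconnected_of_eventuallyEq_zero
    (convex_ball z0 ρ0).isPreconnected (Metric.mem_ball_self hρ0) hev hz)

lemma nondeg_unif {N : ℕ} (b : Fin N → ℂ → ℝ) (z0 : ℂ) (ρ0 : ℝ) (hρ0 : 0 < ρ0)
    (hb : ∀ i, AnalyticOnNhd ℝ (b i) (Metric.ball z0 ρ0))
    (hinj : ∀ c : Fin N → ℝ, (∀ z ∈ Metric.ball z0 ρ0, lc b c z = 0) → c = 0) :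
    ∃ ρ > 0, ρ ≤ ρ0 ∧ ∃ k : ℕ, ∃ η > 0, ∀ c ∈ Metric.sphere (0 : Fin N → ℝ) 1,
      ∃ j ≤ k, ∃ θ : ℂ, ‖θ‖ ≤ 1 ∧ ∀ z ∈ Metric.ball z0 ρ, η ≤ |dirD j (lc b c) θ z| := by
  refine (isCompact_sphere (0 : Fin N → ℝ) 1).induction_on
    (p := fun K => ∃ ρ > 0, ρ ≤ ρ0 ∧ ∃ k : ℕ, ∃ η > 0, ∀ c ∈ K,
      ∃ j ≤ k, ∃ θ : ℂ, ‖θ‖ ≤ 1 ∧ ∀ z ∈ Metric.ball z0 ρ, η ≤ |dirD j (lc b c) θ z|) ?_ ?_ ?_ ?_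
  · exact ⟨ρ0, hρ0, le_rfl, 0, 1, one_pos, by simp⟩
  · rintro s t hst ⟨ρ, h1, h2, k, η, h3, h4⟩
    exact ⟨ρ, h1, h2, k, η, h3, fun c hc => h4 c (hst hc)⟩
  · rintro s t ⟨ρ, h1, h2, k, η, h3, h4⟩ ⟨ρ', h1', h2', k', η', h3', h4'⟩
    refine ⟨min ρ ρ', lt_min h1 h1', (min_le_left _ _).trans h2, max k k', min η η',
      lt_min h3 h3', ?_⟩
    rintro c (hc | hc)
    · obtain ⟨j, hj, θ, hθ, h⟩ := h4 c hc
      exact ⟨j, hj.trans (le_max_left _ _), θ, hθ, fun z hz =>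
        (min_le_left _ _).trans (h z (Metric.ball_subset_ball (min_le_left _ _) hz))⟩
    · obtain ⟨j, hj, θ, hθ, h⟩ := h4' c hc
      exact ⟨j, hj.trans (le_max_right _ _), θ, hθ, fun z hz =>
        (min_le_right _ _).trans (h z (Metric.ball_subset_ball (min_le_right _ _) hz))⟩
  · intro c hc
    have hz0 : z0 ∈ Metric.ball z0 ρ0 := Metric.mem_ball_self hρ0
    have hcne : ∃ z ∈ Metric.ball z0 ρ0, lc b c z ≠ 0 := by
      by_contra hcon
      push Not at hcon
      have := hinj c hcon
      rw [this] at hc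
      simp at hc
    obtain ⟨j, θ, hθ, hne⟩ := nondeg (lc b c) z0 ρ0 hρ0
      (fun z hz => lc_analytic b c z fun i => hb i z hz) hcne
    set G : (Fin N → ℝ) × ℂ → ℝ := fun q => |∑ i, q.1 i * dirD j (b i) θ q.2| with hG
    have hGc : ContinuousAt G (c, z0) := by
      refine ContinuousAt.abs ?_
      refine tendsto_finsetSum _ fun i _ => ?_
      refine Filter.Tendsto.mul ?_ ?_
      · exact ((continuous_apply i).comp continuous_fst).continuousAt
      · exact ContinuousAt.comp (f := Prod.snd) (g := dirD j (b i) θ) (x := (c, z0))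
          (dirD_continuousAt (b i) z0 (hb i z0 hz0) j θ) continuousAt_snd
    set η := |dirD j (lc b c) θ z0| / 2 with hη
    have hηpos : 0 < η := by have := abs_pos.mpr hne; positivity
    have hlt : η < G (c, z0) := by
      rw [hG]; simp only
      rw [← dirD_lc b c z0 (fun i => hb i z0 hz0) j θ]
      have := abs_pos.mpr hne
      rw [hη]; linarith
    have hev := hGc.eventually (lt_mem_nhds hlt)
    rw [nhds_prod_eq, Filter.eventually_prod_iff] at hev
    obtain ⟨pa, hpa, pb, hpb, hp⟩ := hev
    obtain ⟨ρ, hρ, hρb⟩ := Metric.eventually_nhds_iff_ball.mp hpb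
    refine ⟨{c | pa c}, mem_nhdsWithin_of_mem_nhds hpa, min ρ ρ0, lt_min hρ hρ0, min_le_right _ _,
      j, η, hηpos, ?_⟩
    intro c' hc'
    refine ⟨j, le_rfl, θ, hθ, fun z hz => ?_⟩
    have := hp hc' (hρb z (Metric.ball_subset_ball (min_le_left _ _) hz))
    rw [dirD_lc b c' z (fun i => hb i z (Metric.ball_subset_ball (min_le_right _ _) hz)) j θ]
    exact this.le

lemma lower_bound (F : ℂ → ℝ) (z0 : ℂ) (ρ : ℝ) (hF : AnalyticOnNhd ℝ F (Metric.ball z0 ρ))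
    (k j : ℕ) (hj : j ≤ k) (η : ℝ) (hη : 0 < η) (θ : ℂ) (hθ : ‖θ‖ ≤ 1)
    (hD : ∀ z ∈ Metric.ball z0 ρ, η ≤ |dirD j F θ z|) (x : ℂ) (r : ℝ) (hr : 0 < r) (hr1 : r ≤ 1)
    (hB : Metric.ball x r ⊆ Metric.ball z0 ρ) (S : ℝ) (hS : ∀ y ∈ Metric.ball x r, |F y| ≤ S) :
    η / ((k + 1) ^ k * (k + 1).factorial) * r ^ k ≤ S := by
  set δ := r / (j + 1) with hδ
  have hδ0 : 0 < δ := by positivity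
  have hmem : ∀ s ∈ Set.Ico (0:ℝ) r, x + s * θ ∈ Metric.ball x r := by
    intro s hs
    rw [Metric.mem_ball, dist_eq_norm, add_sub_cancel_left, norm_mul, Complex.norm_real,
      Real.norm_eq_abs, abs_of_nonneg hs.1]
    nlinarith [hs.1, hs.2, norm_nonneg θ]
  have hinj : Function.Injective (fun i : ℕ => (i:ℝ) * δ) := by
    intro a b hab
    have := mul_right_cancel₀ hδ0.ne' hab
    exact_mod_cast this
  obtain ⟨ξ, h1, h2⟩ := divided_diff_bound (Set.Ico 0 r) Set.ordConnected_Ico j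
    (fun i s => dirD i F θ (x + s * θ))
    (fun i _ s hs => dirD_hasDerivAt F _ hF i x θ s (hB (hmem s hs)))
    ((Finset.range (j+1)).image (fun i : ℕ => (i:ℝ) * δ))
    (by
      intro s hs
      simp only [Finset.mem_image, Finset.mem_range] at hs
      obtain ⟨i, hi, rfl⟩ := hs
      refine ⟨by positivity, ?_⟩
      have : (i:ℝ) < j + 1 := by exact_mod_cast hi
      have h3 : r = (j + 1) * δ := by rw [hδ]; field_simp
      rw [h3]
      exact mul_lt_mul_of_pos_right this hδ0)
    (by rw [Finset.card_image_of_injective _ hinj, Finset.card_range])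
    δ S hδ0
    (by
      intro s hs t ht hst
      simp only [Finset.mem_image, Finset.mem_range] at hs ht
      obtain ⟨i, hi, rfl⟩ := hs
      obtain ⟨i', hi', rfl⟩ := ht
      have hne : (i:ℤ) - i' ≠ 0 := by
        intro h; apply hst; have : i = i' := by omega
        rw [this]
      have h4 : (1:ℝ) ≤ |(i:ℝ) - i'| := by
        have := Int.one_le_abs hne
        exact_mod_cast this
      rw [← sub_mul, abs_mul, abs_of_pos hδ0]
      nlinarith)
    (by
      intro s hs
      simp only [Finset.mem_image, Finset.mem_range] at hs
      obtain ⟨i, hi, rfl⟩ := hs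
      rw [dirD_zero]
      refine hS _ (hmem _ ⟨by positivity, ?_⟩)
      have : (i:ℝ) < j + 1 := by exact_mod_cast hi
      have h3 : r = (j + 1) * δ := by rw [hδ]; field_simp
      rw [h3]
      exact mul_lt_mul_of_pos_right this hδ0)
  have h3 := (hD _ (hB (hmem ξ h1))).trans h2
  have hS0 : 0 ≤ S := (abs_nonneg _).trans (hS x (Metric.mem_ball_self hr))
  have h4 : (j.factorial : ℝ) * ((j + 1) * (S / δ ^ j)) =
      ((j+1).factorial * (j+1)^j) * S / r ^ j := by
    rw [hδ, Nat.factorial_succ]; push_cast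
    rw [div_pow]; field_simp
  rw [h4, le_div_iff₀ (by positivity)] at h3
  have h5 : ((j+1).factorial : ℝ) ≤ (k+1).factorial := by
    exact_mod_cast Nat.factorial_le (by omega)
  have h6 : ((j:ℝ)+1)^j ≤ (k+1)^k := by
    have : (j:ℝ) ≤ k := by exact_mod_cast hj
    calc ((j:ℝ)+1)^j ≤ (k+1)^j := by gcongr
      _ ≤ (k+1)^k := pow_le_pow_right₀ (by linarith [Nat.cast_nonneg (α := ℝ) k]) hj
  have h7 : r ^ k ≤ r ^ j := pow_le_pow_of_le_one hr.le hr1 hj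
  rw [div_mul_eq_mul_div, div_le_iff₀ (by positivity)]
  calc η * r ^ k ≤ η * r ^ j := by gcongr
    _ ≤ _ := h3
    _ ≤ ((k+1).factorial * (k+1)^k) * S := by gcongr
    _ = _ := by ring

lemma upper_bound {N : ℕ} (b : Fin N → ℂ → ℝ) (z0 : ℂ)
    (hb : ∀ i, ∀ᶠ z in nhds z0, AnalyticAt ℝ (b i) z) (m : ℕ) :
    ∃ A > 0, ∃ ρ > 0, ∀ z ∈ Metric.ball z0 ρ, ∀ c : Fin N → ℝ, ∀ θ : ℂ, ‖θ‖ ≤ 1 →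
      |dirD m (lc b c) θ z| ≤ A * ‖c‖ := by
  have h1 : ∀ i, ∀ᶠ z in nhds z0, ‖iteratedFDeriv ℝ m (b i) z‖ <
      ‖iteratedFDeriv ℝ m (b i) z0‖ + 1 := by
    intro i
    have hF : AnalyticAt ℝ (b i) z0 := (hb i).self_of_nhds
    have h1 : ContinuousAt (iteratedFDeriv ℝ m (b i)) z0 :=
      ((hF.contDiffAt (n := ⊤)).differentiableAt_iteratedFDeriv (m := m) (by simp)).continuousAt
    exact h1.norm.eventually (gt_mem_nhds (by linarith))
  obtain ⟨ρ, hρ, h⟩ := Metric.eventually_nhds_iff_ball.mp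
    ((Filter.eventually_all.mpr hb).and (Filter.eventually_all.mpr h1))
  refine ⟨∑ i, (‖iteratedFDeriv ℝ m (b i) z0‖ + 1) + 1, by positivity, ρ, hρ, ?_⟩
  intro z hz c θ hθ
  obtain ⟨ha, hn⟩ := h z hz
  rw [dirD_lc b c z ha]
  have : ∀ i ∈ Finset.univ, |c i * dirD m (b i) θ z| ≤
      (‖iteratedFDeriv ℝ m (b i) z0‖ + 1) * ‖c‖ := by
    intro i _
    rw [abs_mul, mul_comm]
    have e1 : |dirD m (b i) θ z| ≤ ‖iteratedFDeriv ℝ m (b i) z‖ := by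
      have := (iteratedFDeriv ℝ m (b i) z).le_opNorm (fun _ => θ)
      simp only [Finset.prod_const, Finset.card_univ, Fintype.card_fin] at this
      refine this.trans ?_
      have h3 : ‖θ‖ ^ m ≤ 1 := pow_le_one₀ (norm_nonneg _) hθ
      nlinarith [norm_nonneg (iteratedFDeriv ℝ m (b i) z)]
    have e2 : |c i| ≤ ‖c‖ := norm_le_pi_norm c i
    have e3 := (hn i).le
    exact mul_le_mul (e1.trans e3) e2 (abs_nonneg _) (by positivity)
  refine (Finset.abs_sum_le_sum_abs _ _).trans ((Finset.sum_le_sum this).trans ?_)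
  rw [← Finset.sum_mul]
  gcongr
  linarith

lemma radius_le (x z0 : ℂ) (r ρ : ℝ) (hr : 0 < r) (hρ : 0 < ρ)
    (h : Metric.ball x r ⊆ Metric.ball z0 ρ) : r ≤ ρ := by
  have h1 := measure_mono (μ := volume) h
  rw [Complex.volume_ball, Complex.volume_ball] at h1
  rw [ENNReal.mul_le_mul_iff_left (by simpa using NNReal.pi_ne_zero) (by simp)] at h1
  rw [← ENNReal.ofReal_pow hr.le, ← ENNReal.ofReal_pow hρ.le,
    ENNReal.ofReal_le_ofReal_iff (by positivity)] at h1
  exact le_of_sq_le_sq h1 hρ.le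

lemma core {N : ℕ} (b : Fin N → ℂ → ℝ) (z0 : ℂ) (ρ0 : ℝ) (hρ0 : 0 < ρ0)
    (hb : ∀ i, AnalyticOnNhd ℝ (b i) (Metric.ball z0 ρ0))
    (hinj : ∀ c : Fin N → ℝ, (∀ z ∈ Metric.ball z0 ρ0, lc b c z = 0) → c = 0) :
    ∃ ρ > 0, ρ ≤ ρ0 ∧ ∃ C > (0:ℝ), ∃ α > (0:ℝ), ∀ (c : Fin N → ℝ) (x : ℂ) (r : ℝ),
      Metric.ball x r ⊆ Metric.ball z0 ρ → ∀ p ∈ Metric.ball x r,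
      (∀ y ∈ Metric.ball x r, |lc b c y| ≤ 4 * |lc b c p|) → ∀ ε : ℝ, 0 < ε →
      volume {y ∈ Metric.ball x r | |lc b c y| < ε * |lc b c p|} ≤
        ENNReal.ofReal (C * ε ^ α) * volume (Metric.ball x r) := by
  obtain ⟨ρ1, hρ1, hρ10, k, η, hη, hnd⟩ := nondeg_unif b z0 ρ0 hρ0 hb hinj
  obtain ⟨A, hA, ρ2, hρ2, hup⟩ := upper_bound b z0 (fun i => by
    filter_upwards [Metric.ball_mem_nhds z0 hρ0] with z hz using hb i z hz) (k+1)
  set γ := η / ((k + 1) ^ k * (k + 1).factorial) with hγ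
  have hγ0 : 0 < γ := by positivity
  set ρ := min (min ρ1 ρ2) (min 1 (γ / (A * 2 ^ (k+4)))) with hρ
  have hρpos : 0 < ρ := by positivity
  have l1 : ρ ≤ ρ1 := (min_le_left _ _).trans (min_le_left _ _)
  have l2 : ρ ≤ ρ2 := (min_le_left _ _).trans (min_le_right _ _)
  have l3 : ρ ≤ 1 := (min_le_right _ _).trans (min_le_left _ _)
  have l4 : ρ ≤ γ / (A * 2 ^ (k+4)) := (min_le_right _ _).trans (min_le_right _ _)
  set n := k + 1 with hn
  refine ⟨ρ, hρpos, l1.trans hρ10, 16 * n * (4 * n) ^ (1 / (n:ℝ)), by positivity, 1 / (n:ℝ),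
    by positivity, ?_⟩
  intro c x r hB p hp hmax ε hε
  have hr : 0 < r := Metric.pos_of_mem_ball hp
  have hrρ : r ≤ ρ := radius_le x z0 r ρ hr hρpos hB
  set F := lc b c with hF
  rcases (abs_nonneg (F p)).eq_or_lt with hT | hT
  · have : {y ∈ Metric.ball x r | |F y| < ε * |F p|} = ∅ := by
      ext y
      simp only [Set.mem_ofPred_eq, Set.mem_empty_iff_false, iff_false, not_and, not_lt]
      intro _
      rw [← hT]; simp
    rw [this]; simp
  have hc0 : c ≠ 0 := by
    rintro rfl
    simp [hF, lc] at hT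
  have hcn : 0 < ‖c‖ := norm_pos_iff.mpr hc0
  have hFan : AnalyticOnNhd ℝ F (Metric.ball z0 ρ) := fun z hz =>
    lc_analytic b c z fun i => hb i z (Metric.ball_subset_ball (l1.trans hρ10) hz)
  -- lower bound
  have hlow : γ * ‖c‖ * r ^ k ≤ 4 * |F p| := by
    obtain ⟨j, hj, θ, hθ, hD⟩ := hnd (‖c‖⁻¹ • c) (by
      rw [mem_sphere_zero_iff_norm, norm_smul, norm_inv, norm_norm, inv_mul_cancel₀ hcn.ne'])
    have hsc : ∀ y, lc b (‖c‖⁻¹ • c) y = ‖c‖⁻¹ * F y := by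
      intro y; simp [hF, lc, Finset.mul_sum, mul_assoc]
    have := lower_bound (lc b (‖c‖⁻¹ • c)) z0 ρ (fun z hz =>
      lc_analytic b _ z fun i => hb i z (Metric.ball_subset_ball (l1.trans hρ10) hz)) k j hj η hη
      θ hθ (fun z hz => hD z (Metric.ball_subset_ball l1 hz)) x r hr (hrρ.trans l3) hB
      (‖c‖⁻¹ * (4 * |F p|)) (by
        intro y hy
        rw [hsc, abs_mul, abs_of_pos (by positivity)]
        have := hmax y hy
        gcongr)
    rw [← hγ, inv_mul_eq_div, le_div_iff₀ hcn] at this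
    linarith
  have hEm : MeasurableSet {y ∈ Metric.ball x r | |F y| < ε * |F p|} := by
    have hcont : ContinuousOn (fun y => |F y|) (Metric.ball x r) :=
      (hFan.continuousOn.mono hB).abs
    exact (hcont.isOpen_inter_preimage Metric.isOpen_ball (isOpen_Iio (a := ε * |F p|))).measurableSet
  have hpol := polar_bound _ hEm p (2 * r) (ENNReal.ofReal (2 * n * (2 * r * (4 * n * ε) ^ (1 / (n:ℝ)))))
    (by
      rintro y ⟨hy, -⟩
      rw [← dist_eq_norm]
      have h1 := dist_triangle_right y p x
      have h2 := Metric.mem_ball.mp hy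
      have h3 := Metric.mem_ball.mp hp
      linarith)
    (by
      intro t
      set θ : ℂ := Real.cos t + Real.sin t * Complex.I with hθ
      have hθn : ‖θ‖ = 1 := by
        simp [hθ]
      set I : Set ℝ := {s : ℝ | p + s * θ ∈ Metric.ball x r} with hI
      have hIc : Convex ℝ I := by
        have : I = (AffineMap.lineMap p (p + θ) : ℝ →ᵃ[ℝ] ℂ) ⁻¹' (Metric.ball x r) := by
          ext s
          simp [hI, AffineMap.lineMap_apply, add_comm]
        rw [this]
        exact (convex_ball x r).affine_preimage _
      have hseg := seg_measure n (by omega) (fun i s => dirD i F θ (p + s * θ)) (2 * r) (by positivity)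
        I hIc.ordConnected (by simpa [hI] using hp)
        (by
          intro s hs
          have h1 := dist_triangle_right (p + s * θ) p x
          have h2 := Metric.mem_ball.mp (show p + s * θ ∈ Metric.ball x r from hs)
          have h3 := Metric.mem_ball.mp hp
          rw [dist_eq_norm, add_sub_cancel_left, norm_mul, hθn, mul_one, Complex.norm_real,
            Real.norm_eq_abs] at h1
          linarith)
        (fun i _ s hs => dirD_hasDerivAt F _ hFan i p θ s (hB hs))
        ε (A * ‖c‖) hε (by simpa [dirD_zero] using hT)
        (fun s hs => hup _ (Metric.ball_subset_ball l2 (hB hs)) c θ hθn.le)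
        (by
          simp only [dirD_zero, Complex.ofReal_zero, zero_mul, add_zero]
          rw [le_div_iff₀ (by positivity)]
          have h1 : r * (A * 2 ^ (k+4)) ≤ γ := by
            rw [← le_div_iff₀ (by positivity)]; exact hrρ.trans l4
          have h2 : (r * (A * 2 ^ (k+4))) * (‖c‖ * r ^ k) ≤ γ * (‖c‖ * r ^ k) := by gcongr
          have h3 : (r * (A * 2 ^ (k+4))) * (‖c‖ * r ^ k) =
              4 * (A * ‖c‖ * (2 * (2 * r) ^ n)) := by
            rw [hn]; ring
          rw [h3] at h2
          linarith)
      simp only [dirD_zero, Complex.ofReal_zero, zero_mul, add_zero] at hseg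
      refine (measure_mono ?_).trans hseg
      rintro s ⟨hs0, hs1, hs2⟩
      exact ⟨hs0, hs1, hs2⟩)
  refine hpol.trans (le_of_eq ?_)
  rw [Complex.volume_ball]
  have hpi : (NNReal.pi : ENNReal) = ENNReal.ofReal Real.pi := by
    rw [← NNReal.coe_real_pi, ENNReal.ofReal_coe_nnreal]
  rw [hpi, ← ENNReal.ofReal_pow hr.le, ← ENNReal.ofReal_mul (by positivity),
    ← ENNReal.ofReal_mul (by positivity), ← ENNReal.ofReal_mul (by positivity),
    ← ENNReal.ofReal_mul (by positivity), Real.mul_rpow (by positivity) hε.le]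
  congr 1
  ring

/-- functions real-analytic on a set -/
def anSub (B : Set ℂ) : Subalgebra ℝ (ℂ → ℝ) where
  carrier := {g | AnalyticOnNhd ℝ g B}
  mul_mem' := fun ha hb => fun z hz => (ha z hz).mul (hb z hz)
  add_mem' := fun ha hb => fun z hz => (ha z hz).add (hb z hz)
  algebraMap_mem' := fun _ => fun _ _ => analyticAt_const

lemma prod_mem_pow {A : Type*} [CommRing A] [Algebra ℝ A] (W : Submodule ℝ A) {ι : Type*}
    (s : Finset ι) (g : ι → A) (h : ∀ i ∈ s, g i ∈ W) : ∏ i ∈ s, g i ∈ W ^ s.card := by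
  classical
  induction s using Finset.induction_on with
  | empty => simp [Submodule.one_le.mp]
  | insert a s ha ih =>
    rw [Finset.prod_insert ha, Finset.card_insert_of_notMem ha, pow_succ']
    exact Submodule.mul_mem_mul (h a (Finset.mem_insert_self _ _))
      (ih fun i hi => h i (Finset.mem_insert_of_mem hi))

lemma fg_pow' {A : Type*} [CommRing A] [Algebra ℝ A] (W : Submodule ℝ A) (hW : W.FG) (m : ℕ) :
    (W ^ m).FG := by
  induction m with
  | zero =>
    rw [pow_zero, Submodule.one_eq_span]
    exact Submodule.fg_span_singleton 1
  | succ m ih => rw [pow_succ]; exact ih.mul hW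

lemma pow_le_sub {A : Type*} [CommRing A] [Algebra ℝ A] (W : Submodule ℝ A) (S : Subalgebra ℝ A)
    (h : W ≤ Subalgebra.toSubmodule S) (m : ℕ) : W ^ m ≤ Subalgebra.toSubmodule S := by
  induction m with
  | zero =>
    rw [pow_zero, Submodule.one_le]; exact S.one_mem
  | succ m ih =>
    rw [pow_succ, Submodule.mul_le]
    intro a ha b hb
    exact S.mul_mem (ih ha) (h hb)

/-- uniform statement for a finite-dimensional space of analytic functions -/
lemma core_space (V : Submodule ℝ (ℂ → ℝ)) (hV : V.FG) (z0 : ℂ) (ρ0 : ℝ) (hρ0 : 0 < ρ0)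
    (hVa : ∀ g ∈ V, AnalyticOnNhd ℝ g (Metric.ball z0 ρ0)) :
    ∃ ρ > 0, ρ ≤ ρ0 ∧ ∃ C > (0:ℝ), ∃ α > (0:ℝ), ∀ F ∈ V, ∀ (x : ℂ) (r : ℝ),
      Metric.ball x r ⊆ Metric.ball z0 ρ → ∀ p ∈ Metric.ball x r,
      (∀ y ∈ Metric.ball x r, |F y| ≤ 4 * |F p|) → ∀ ε : ℝ, 0 < ε →
      volume {y ∈ Metric.ball x r | |F y| < ε * |F p|} ≤
        ENNReal.ofReal (C * ε ^ α) * volume (Metric.ball x r) := by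
  classical
  set B := Metric.ball z0 ρ0 with hB
  set χ : ℂ → ℝ := B.indicator 1 with hχ
  have hχ1 : ∀ z ∈ B, χ z = 1 := fun z hz => by rw [hχ, Set.indicator_of_mem hz]; rfl
  have hχ0 : ∀ z ∉ B, χ z = 0 := fun z hz => by rw [hχ, Set.indicator_of_notMem hz]
  set V' := V.map (LinearMap.mulLeft ℝ χ) with hV'
  have hV'fg : V'.FG := hV.map _
  haveI : Module.Finite ℝ V' := Module.Finite.iff_fg.mpr hV'fg
  set e := Module.finBasis ℝ V' with he
  set b : Fin (Module.finrank ℝ V') → ℂ → ℝ := fun i => (e i : ℂ → ℝ) with hb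
  have hlc : ∀ c, lc b c = ((∑ i, c i • e i : V') : ℂ → ℝ) := by
    intro c; ext z
    simp [lc, hb]
  have hstruct : ∀ h ∈ V', (∀ z ∉ B, h z = 0) ∧ AnalyticOnNhd ℝ h B := by
    rintro h ⟨g, hg, rfl⟩
    refine ⟨fun z hz => by simp [hχ0 z hz], fun z hz => ?_⟩
    refine (hVa g hg z hz).congr ?_
    filter_upwards [Metric.isOpen_ball.mem_nhds hz] with y hy
    simp [hχ1 y hy]
  obtain ⟨ρ, hρ, hρ0', C, hC, α, hα, H⟩ := core b z0 ρ0 hρ0 (fun i => (hstruct _ (e i).2).2) (by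
    intro c hc
    have h1 : (∑ i, c i • e i : V') = 0 := by
      apply Subtype.ext
      ext z
      by_cases hz : z ∈ B
      · rw [← hlc]; simpa using hc z hz
      · simpa using (hstruct _ (∑ i, c i • e i : V').2).1 z hz
    funext i
    exact Fintype.linearIndependent_iff.mp e.linearIndependent c h1 i)
  refine ⟨ρ, hρ, hρ0', C, hC, α, hα, ?_⟩
  intro F hF x r hxr p hp hmax ε hε
  have hsub : Metric.ball x r ⊆ B := hxr.trans (Metric.ball_subset_ball hρ0')
  have hFV : χ * F ∈ V' := ⟨F, hF, rfl⟩
  have hrep : lc b (e.repr ⟨_, hFV⟩) = χ * F := by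
    rw [hlc, e.sum_repr]
  have heq : ∀ y ∈ Metric.ball x r, lc b (e.repr ⟨_, hFV⟩) y = F y := by
    intro y hy
    rw [hrep]; simp [hχ1 y (hsub hy)]
  have := H (e.repr ⟨_, hFV⟩) x r hxr p hp (by
    intro y hy
    rw [heq y hy, heq p hp]; exact hmax y hy) ε hε
  refine le_trans (measure_mono ?_) this
  rintro y ⟨hy, hy2⟩
  exact ⟨hy, by rw [heq y hy, heq p hp]; exact hy2⟩

/-- passing from the square to the square root -/
lemma good_sqrt (F : ℂ → ℝ) (hF0 : ∀ z, 0 ≤ F z) (z0 : ℂ) (ρ C α : ℝ) (hC : 0 < C)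
    (H : ∀ (x : ℂ) (r : ℝ),
      Metric.ball x r ⊆ Metric.ball z0 ρ → ∀ p ∈ Metric.ball x r,
      (∀ y ∈ Metric.ball x r, |F y| ≤ 4 * |F p|) → ∀ ε : ℝ, 0 < ε →
      volume {y ∈ Metric.ball x r | |F y| < ε * |F p|} ≤
        ENNReal.ofReal (C * ε ^ α) * volume (Metric.ball x r)) :
    IsGoodC (C * 4 ^ α) (2 * α) (Metric.ball z0 ρ) (fun z => Real.sqrt (F z)) := by
  intro x r hxr ε hε
  set G : ℂ → ℝ := fun w => ⨆ (_ : w ∈ Metric.ball x r), |Real.sqrt (F w)| with hG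
  have hGin : ∀ w ∈ Metric.ball x r, G w = Real.sqrt (F w) := by
    intro w hw
    simp only [hG]
    rw [ciSup_pos hw, abs_of_nonneg (Real.sqrt_nonneg _)]
  have hGout : ∀ w ∉ Metric.ball x r, G w = 0 := by
    intro w hw
    simp only [hG]
    haveI : IsEmpty (w ∈ Metric.ball x r) := ⟨hw⟩
    exact Real.iSup_of_isEmpty _
  set S := ⨆ w, G w with hS
  change volume {y ∈ Metric.ball x r | |Real.sqrt (F y)| < ε * S} ≤ _
  rcases le_or_gt S 0 with hS0 | hS0
  · have : {y ∈ Metric.ball x r | |Real.sqrt (F y)| < ε * S} = ∅ := by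
      ext y
      simp only [Set.mem_ofPred_eq, Set.mem_empty_iff_false, iff_false, not_and, not_lt]
      intro _
      exact (mul_nonpos_of_nonneg_of_nonpos hε.le hS0).trans (abs_nonneg _)
    rw [this]; simp
  have hbdd : BddAbove (Set.range G) := by
    by_contra hcon
    rw [hS, Real.iSup_of_not_bddAbove hcon] at hS0
    exact lt_irrefl _ hS0
  obtain ⟨p, hp⟩ := exists_lt_of_lt_ciSup (show S / 2 < ⨆ w, G w by rw [← hS]; linarith)
  have hpB : p ∈ Metric.ball x r := by
    by_contra hcon
    rw [hGout p hcon] at hp; linarith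
  rw [hGin p hpB] at hp
  have hFp : S ^ 2 < 4 * F p := by
    have h1 := Real.sq_sqrt (hF0 p)
    nlinarith
  have hle : ∀ y ∈ Metric.ball x r, F y ≤ S ^ 2 := by
    intro y hy
    have h1 : Real.sqrt (F y) ≤ S := by rw [← hGin y hy]; exact le_ciSup hbdd y
    have h2 := Real.sq_sqrt (hF0 y)
    nlinarith [Real.sqrt_nonneg (F y)]
  have key := H x r hxr p hpB (by
    intro y hy
    rw [abs_of_nonneg (hF0 y), abs_of_nonneg (hF0 p)]
    linarith [hle y hy]) (4 * ε ^ 2) (by positivity)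
  have hconst : C * (4 * ε ^ 2) ^ α = C * 4 ^ α * ε ^ (2 * α) := by
    rw [Real.mul_rpow (by norm_num) (by positivity), Real.rpow_mul hε.le, mul_assoc]
    norm_num
  rw [hconst] at key
  refine le_trans (measure_mono ?_) key
  rintro y ⟨hy, hy2⟩
  refine ⟨hy, ?_⟩
  rw [abs_of_nonneg (Real.sqrt_nonneg _)] at hy2
  rw [abs_of_nonneg (hF0 y), abs_of_nonneg (hF0 p)]
  have h2 := Real.sq_sqrt (hF0 y)
  have h3 : Real.sqrt (F y) ^ 2 < (ε * S) ^ 2 := by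
    have := Real.sqrt_nonneg (F y)
    gcongr
  have h4 : 0 < ε ^ 2 := by positivity
  nlinarith

lemma gram_nonneg {m l : ℕ} (w : Fin l → (Fin m → ℝ)) :
    0 ≤ Matrix.det (Matrix.of fun i j => ∑ a, w i a * w j a) := by
  have h : (Matrix.of fun i j => ∑ a, w i a * w j a) =
      (Matrix.of w) * (Matrix.of w).conjTranspose := by
    ext i j; simp [Matrix.mul_apply]
  rw [h]
  exact (Matrix.posSemidef_self_mul_conjTranspose (Matrix.of w)).det_nonneg

theorem lemma_three_one_a (n : ℕ) (hn : 1 ≤ n) (U : Set ℂ) (hUo : IsOpen U)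
    (f : ℂ → (Fin n → ℂ)) (hf : AnalyticOnNhd ℂ f U) :
    ∀ z₀ ∈ U, ∃ r : ℝ, 0 < r ∧ Metric.ball z₀ r ⊆ U ∧
      ∃ C : ℝ, 0 < C ∧ ∃ α : ℝ, 0 < α ∧
        ∀ t : Fin n → ℝ, (∀ i, 0 ≤ t i) →
        ∀ l : ℕ, 1 ≤ l → ∀ w : Fin l → (Fin (n + 2) → ℝ),
          (∀ i, w i ∈ LambdaSet n) → LinearIndependent ℝ w →
          IsGoodC C α (Metric.ball z₀ r)
            (fun z => covol fun i => gApply n t (uApply n (f z) (w i))) := by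
  intro z₀ hz₀
  obtain ⟨ρ0, hρ0, hsub⟩ := Metric.isOpen_iff.mp hUo z₀ hz₀
  set gens : Set (ℂ → ℝ) := {1} ∪ (Set.range (fun (j : Fin n) (z : ℂ) => (f z j).re) ∪
    Set.range (fun (j : Fin n) (z : ℂ) => (f z j).im)) with hgens
  have hfin : gens.Finite :=
    (Set.finite_singleton _).union ((Set.finite_range _).union (Set.finite_range _))
  set W := Submodule.span ℝ gens with hW
  have hWfg : W.FG := Submodule.fg_span hfin
  have h1W : (1 : ℂ → ℝ) ∈ W := Submodule.subset_span (Or.inl rfl)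
  have hre : ∀ j, (fun z => (f z j).re) ∈ W := fun j =>
    Submodule.subset_span (Or.inr (Or.inl ⟨j, rfl⟩))
  have him : ∀ j, (fun z => (f z j).im) ∈ W := fun j =>
    Submodule.subset_span (Or.inr (Or.inr ⟨j, rfl⟩))
  have hWa : W ≤ Subalgebra.toSubmodule (anSub (Metric.ball z₀ ρ0)) := by
    rw [hW, Submodule.span_le]
    have hfj : ∀ j, ∀ z ∈ Metric.ball z₀ ρ0, AnalyticAt ℝ (fun z => f z j) z := fun j z hz =>
      ((analyticAt_pi_iff.mp (hf z (hsub hz))) j).restrictScalars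
    rintro g (rfl | ⟨j, rfl⟩ | ⟨j, rfl⟩)
    · exact (anSub _).one_mem
    · intro z hz
      exact (Complex.reCLM.analyticAt _).comp (hfj j z hz)
    · intro z hz
      exact (Complex.imCLM.analyticAt _).comp (hfj j z hz)
  set V := W ^ (2 * (n + 2)) with hV
  obtain ⟨ρ, hρ, hρ', C, hC, α, hα, H⟩ := core_space V (fg_pow' W hWfg _) z₀ ρ0 hρ0
    (fun g hg => pow_le_sub W _ hWa _ hg)
  refine ⟨ρ, hρ, (Metric.ball_subset_ball hρ').trans hsub, C * 4 ^ α, by positivity, 2 * α,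
    by positivity, ?_⟩
  intro t _ l _ w _ hw
  have hl : l ≤ n + 2 := by
    have := hw.fintype_card_le_finrank
    simpa using this
  unfold covol
  refine good_sqrt _ (fun z => gram_nonneg _) z₀ ρ C α hC (H _ ?_)
  -- membership
  have hconst : ∀ a : ℝ, (fun _ : ℂ => a) ∈ W := by
    intro a
    have := W.smul_mem a h1W
    convert this using 1
    ext z; simp
  have hu : ∀ i a, (fun z => gApply n t (uApply n (f z) (w i)) a) ∈ W := by
    intro i a
    have hlin : ∀ (h : Fin n → ℂ → ℝ), (∀ j, h j ∈ W) → ∀ s a0 : ℝ,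
        (fun z => s * (a0 + ∑ j, h j z * w i j.succ.succ)) ∈ W := by
      intro h hh s a0
      have : (fun z => s * (a0 + ∑ j, h j z * w i j.succ.succ)) =
          s • ((fun _ : ℂ => a0) + ∑ j, (w i j.succ.succ) • h j) := by
        ext z; simp [mul_comm]
      rw [this]
      exact W.smul_mem _ (W.add_mem (hconst _) (W.sum_mem fun j _ => W.smul_mem _ (hh j)))
    refine Fin.cases ?_ (fun a => Fin.cases ?_ (fun a => ?_) a) a
    · simpa [gApply, uApply] using hlin _ hre _ _
    · simpa [gApply, uApply] using! hlin _ him _ _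
    · simpa [gApply, uApply] using! hconst _
  set M : Matrix (Fin l) (Fin l) (ℂ → ℝ) := Matrix.of fun i j =>
    ∑ a, (fun z => gApply n t (uApply n (f z) (w i)) a) *
      (fun z => gApply n t (uApply n (f z) (w j)) a) with hM
  have hMmem : ∀ i j, M i j ∈ W ^ 2 := by
    intro i j
    rw [pow_two, hM, Matrix.of_apply]
    exact Submodule.sum_mem _ fun a _ => Submodule.mul_mem_mul (hu i a) (hu j a)
  have hdet : (fun z => Matrix.det (Matrix.of fun i j => ∑ a,
      gApply n t (uApply n (f z) (w i)) a * gApply n t (uApply n (f z) (w j)) a)) = M.det := by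
    ext z
    have := RingHom.map_det (Pi.evalRingHom (fun _ : ℂ => ℝ) z) M
    rw [Pi.evalRingHom_apply] at this
    rw [this]
    congr 1
    ext i j
    simp [hM]
  rw [hdet]
  have h1 : M.det ∈ (W ^ 2) ^ l := by
    rw [Matrix.det_apply]
    refine Submodule.sum_mem _ fun σ _ => ?_
    have h2 := prod_mem_pow (W ^ 2) Finset.univ (fun i => M (σ i) i) (fun i _ => hMmem _ _)
    rw [Finset.card_univ, Fintype.card_fin] at h2
    rcases Int.units_eq_one_or (Equiv.Perm.sign σ) with h | h
    · rw [h, one_smul]; exact h2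
    · rw [h, Units.neg_smul, one_smul]; exact Submodule.neg_mem _ h2
  rw [← pow_mul] at h1
  have hone : 1 ≤ W := Submodule.one_le.mpr h1W
  exact pow_le_pow_right₀ hone (by omega) h1
end

section
/- Let B ⊂ ℂ be a nonempty open ball with closure B̄, and let 𝓕 be a nonempty compact (in the sup-norm topology on continuous functions B̄ → ℂ) family of pairs (φ₁, φ₂) of continuous functions on B̄ that are holomorphic on B, such that for each (φ₁, φ₂) ∈ 𝓕 the functions φ₁ and φ₂ are linearly independent over ℝ (no (a,b) ∈ ℝ² ∖ {0} with aφ₁ + bφ₂ identically zero on B). Then there exists ρ₂ > 0 such that for every (φ₁, φ₂) ∈ 𝓕, sup_{z ∈ B} |Im(conj(φ₁(z)) · φ₂(z))| ≥ ρ₂. -/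
open MeasureTheory Classical

/-- Extend a continuous function on the closed ball to all of ℂ (by zero outside). -/
noncomputable def cmExt (z₀ : ℂ) (r : ℝ)
    (φ : C(↑(closure (Metric.ball z₀ r)), ℂ)) : ℂ → ℂ :=
  fun z => if h : z ∈ closure (Metric.ball z₀ r) then φ ⟨z, h⟩ else 0

theorem helper_exists (z₀ : ℂ) (r : ℝ) (f g : ℂ → ℂ)
    (hf : DifferentiableOn ℂ f (Metric.ball z₀ r)) (hg : DifferentiableOn ℂ g (Metric.ball z₀ r))
    (hind : ∀ a b : ℝ, (∀ z ∈ Metric.ball z₀ r, (a : ℂ) * f z + (b : ℂ) * g z = 0) →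
      a = 0 ∧ b = 0) :
    ∃ z ∈ Metric.ball z₀ r, 0 < |((starRingEnd ℂ) (f z) * g z).im| := by
  by_contra! hcon
  have him : ∀ z ∈ Metric.ball z₀ r, ((starRingEnd ℂ) (f z) * g z).im = 0 := fun z hz =>
    abs_nonpos_iff.mp (hcon z hz)
  have hw : ∃ w ∈ Metric.ball z₀ r, f w ≠ 0 := by
    by_contra! h
    have := (hind 1 0 (fun z hz => by simp [h z hz])).1
    exact one_ne_zero this
  obtain ⟨w, hwB, hfw⟩ := hw
  have hfa := hf.analyticOnNhd Metric.isOpen_ball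
  have hga := hg.analyticOnNhd Metric.isOpen_ball
  have hq : AnalyticAt ℂ (fun z => g z / f z) w := (hga w hwB).div (hfa w hwB) hfw
  have hBn : Metric.ball z₀ r ∈ nhds w := Metric.isOpen_ball.mem_nhds hwB
  have hre : ∀ z ∈ Metric.ball z₀ r, (g z / f z).im = 0 := by
    intro z hz
    have h := him z hz
    simp only [Complex.mul_im, Complex.conj_re, Complex.conj_im] at h
    rw [Complex.div_im, ← sub_div]
    rw [show (g z).im * (f z).re - (g z).re * (f z).im = 0 by linarith, zero_div]
  have hconst : ∀ᶠ z in nhds w, g z / f z = g w / f w := by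
    rcases hq.eventually_constant_or_nhds_le_map_nhds with h | h
    · exact h
    · exfalso
      have h1 : {u : ℂ | u.im = 0} ∈ Filter.map (fun z => g z / f z) (nhds w) := by
        exact Filter.mem_map.mpr (Filter.mem_of_superset hBn hre)
      have h2 := h h1
      obtain ⟨ε, hε, hb⟩ := Metric.mem_nhds_iff.mp h2
      have h3 : g w / f w + ((ε / 2 : ℝ) : ℂ) * Complex.I ∈ Metric.ball (g w / f w) ε := by
        rw [Metric.mem_ball, dist_eq_norm, add_sub_cancel_left, norm_mul, Complex.norm_I,
          Complex.norm_real, Real.norm_eq_abs, abs_of_pos (by linarith)]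
        linarith
      have h4 : (g w / f w + ((ε / 2 : ℝ) : ℂ) * Complex.I).im = 0 := hb h3
      rw [Complex.add_im, hre w hwB, Complex.im_ofReal_mul, Complex.I_im] at h4
      linarith
  have hc : (((g w / f w).re : ℝ) : ℂ) = g w / f w :=
    Complex.ext (by simp) (by rw [hre w hwB]; simp)
  have hnear : g =ᶠ[nhds w] (fun z => (g w / f w) * f z) := by
    filter_upwards [hconst, (hfa w hwB).continuousAt.eventually_ne hfw] with z hz hz0
    rw [← hz, div_mul_cancel₀ _ hz0]
  have hall := hga.eqOn_of_preconnected_of_eventuallyEq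
    (analyticOnNhd_const.mul hfa) (convex_ball z₀ r).isPreconnected hwB hnear
  have := (hind (-(g w / f w).re) 1 (fun z hz => by
    have h5 : g z = (g w / f w) * f z := hall hz
    rw [Complex.ofReal_neg, hc, h5]; push_cast; ring)).2
  exact one_ne_zero this

theorem helper_le_sup (z₀ : ℂ) (r : ℝ)
    (p : C(↑(closure (Metric.ball z₀ r)), ℂ) × C(↑(closure (Metric.ball z₀ r)), ℂ))
    (w : ℂ) (hw : w ∈ Metric.ball z₀ r) :
    |((starRingEnd ℂ) (cmExt z₀ r p.1 w) * cmExt z₀ r p.2 w).im| ≤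
      ⨆ z ∈ Metric.ball z₀ r,
        |((starRingEnd ℂ) (cmExt z₀ r p.1 z) * cmExt z₀ r p.2 z).im| := by
  haveI : CompactSpace ↑(closure (Metric.ball z₀ r)) :=
    isCompact_iff_compactSpace.mp Metric.isBounded_ball.isCompact_closure
  have hb : ∀ (φ : C(↑(closure (Metric.ball z₀ r)), ℂ)) (z : ℂ), ‖cmExt z₀ r φ z‖ ≤ ‖φ‖ := by
    intro φ z
    unfold cmExt
    split_ifs with h
    · exact φ.norm_coe_le_norm _
    · simp
  have hbd : BddAbove (Set.range fun z => ⨆ _ : z ∈ Metric.ball z₀ r,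
        |((starRingEnd ℂ) (cmExt z₀ r p.1 z) * cmExt z₀ r p.2 z).im|) := by
    refine ⟨‖p.1‖ * ‖p.2‖, ?_⟩
    rintro _ ⟨z, rfl⟩
    refine Real.iSup_le (fun _ => ?_) (by positivity)
    refine (Complex.abs_im_le_norm _).trans ?_
    rw [norm_mul, RCLike.norm_conj]
    exact mul_le_mul (hb _ _) (hb _ _) (norm_nonneg _) (norm_nonneg _)
  refine le_trans ?_ (le_ciSup hbd w)
  simp only [hw, ciSup_unique, le_refl]

theorem lemma_three_two_b (z₀ : ℂ) (r : ℝ) (hr : 0 < r)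
    (F : Set (C(↑(closure (Metric.ball z₀ r)), ℂ) × C(↑(closure (Metric.ball z₀ r)), ℂ)))
    (hFne : F.Nonempty) (hFcomp : IsCompact F)
    (hholo : ∀ p ∈ F, DifferentiableOn ℂ (cmExt z₀ r p.1) (Metric.ball z₀ r) ∧
      DifferentiableOn ℂ (cmExt z₀ r p.2) (Metric.ball z₀ r))
    (hind : ∀ p ∈ F, ∀ a b : ℝ,
      (∀ z ∈ Metric.ball z₀ r,
        (a : ℂ) * cmExt z₀ r p.1 z + (b : ℂ) * cmExt z₀ r p.2 z = 0) → a = 0 ∧ b = 0) :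
    ∃ ρ₂ : ℝ, 0 < ρ₂ ∧ ∀ p ∈ F,
      ρ₂ ≤ ⨆ z ∈ Metric.ball z₀ r,
        |((starRingEnd ℂ) (cmExt z₀ r p.1 z) * cmExt z₀ r p.2 z).im| := by
  clear hFne
  have key : ∀ p ∈ F, ∃ t ∈ nhdsWithin p F, ∃ ρ₂ : ℝ, 0 < ρ₂ ∧ ∀ p ∈ t,
      ρ₂ ≤ ⨆ z ∈ Metric.ball z₀ r,
        |((starRingEnd ℂ) (cmExt z₀ r p.1 z) * cmExt z₀ r p.2 z).im| := by
    intro p hp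
    obtain ⟨w, hw, hpos⟩ := helper_exists z₀ r _ _ (hholo p hp).1 (hholo p hp).2 (hind p hp)
    have hcont : Continuous (fun q : C(↑(closure (Metric.ball z₀ r)), ℂ) ×
        C(↑(closure (Metric.ball z₀ r)), ℂ) =>
        |((starRingEnd ℂ) (cmExt z₀ r q.1 w) * cmExt z₀ r q.2 w).im|) := by
      have hw' : w ∈ closure (Metric.ball z₀ r) := subset_closure hw
      simp only [cmExt, hw', dif_pos]
      have h1 : Continuous (fun q : C(↑(closure (Metric.ball z₀ r)), ℂ) ×
        C(↑(closure (Metric.ball z₀ r)), ℂ) => q.1 ⟨w, hw'⟩) :=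
        (continuous_eval_const _).comp continuous_fst
      have h2 : Continuous (fun q : C(↑(closure (Metric.ball z₀ r)), ℂ) ×
        C(↑(closure (Metric.ball z₀ r)), ℂ) => q.2 ⟨w, hw'⟩) :=
        (continuous_eval_const _).comp continuous_snd
      exact (Complex.continuous_im.comp ((Complex.continuous_conj.comp h1).mul h2)).abs
    refine ⟨_, mem_nhdsWithin_of_mem_nhds
      (hcont.continuousAt.eventually_const_lt (half_lt_self hpos)), _, half_pos hpos, ?_⟩
    intro q hq
    exact (le_of_lt hq).trans (helper_le_sup z₀ r q w hw)
  refine hFcomp.induction_on (p := fun t => ∃ ρ₂ : ℝ, 0 < ρ₂ ∧ ∀ p ∈ t,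
      ρ₂ ≤ ⨆ z ∈ Metric.ball z₀ r,
        |((starRingEnd ℂ) (cmExt z₀ r p.1 z) * cmExt z₀ r p.2 z).im|) ?_ ?_ ?_ key
  · exact ⟨1, one_pos, fun p hp => absurd hp (Set.notMem_empty p)⟩
  · rintro s t hst ⟨ρ, h0, h⟩
    exact ⟨ρ, h0, fun p hp => h p (hst hp)⟩
  · rintro s t ⟨ρ, h0, h⟩ ⟨ρ', h0', h'⟩
    refine ⟨min ρ ρ', lt_min h0 h0', ?_⟩
    rintro p (hp | hp)
    · exact (min_le_left _ _).trans (h p hp)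
    · exact (min_le_right _ _).trans (h' p hp)
end

section
/- Let U ⊆ ℂ be a nonempty connected open set and let φ₁, φ₂ : U → ℂ be holomorphic functions such that φ₂ is not identically zero and Im(conj(φ₁(z)) · φ₂(z)) = 0 for all z ∈ U. Then there exists a real constant c ∈ ℝ such that φ₁(z) = c · φ₂(z) for all z ∈ U. -/
open MeasureTheory

theorem real_ratio_of_im_conj_mul_eq_zero (U : Set ℂ) (hUo : IsOpen U)
    (hUc : IsConnected U) (φ₁ φ₂ : ℂ → ℂ)
    (h₁ : AnalyticOnNhd ℂ φ₁ U) (h₂ : AnalyticOnNhd ℂ φ₂ U)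
    (hne : ¬ ∀ z ∈ U, φ₂ z = 0)
    (him : ∀ z ∈ U, ((starRingEnd ℂ) (φ₁ z) * φ₂ z).im = 0) :
    ∃ c : ℝ, ∀ z ∈ U, φ₁ z = (c : ℂ) * φ₂ z := by
  push Not at hne
  obtain ⟨z₀, hz₀, hz⟩ := hne
  have hev : ∀ᶠ z in nhds z₀, z ∈ U ∧ φ₂ z ≠ 0 :=
    (hUo.eventually_mem hz₀).and ((h₂ z₀ hz₀).continuousAt.eventually_ne hz)
  obtain ⟨r, hr, hB⟩ := Metric.eventually_nhds_iff_ball.1 hev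
  have hf : AnalyticOnNhd ℂ (fun z => φ₁ z / φ₂ z) (Metric.ball z₀ r) := fun z hz =>
    (h₁ z (hB z hz).1).div (h₂ z (hB z hz).1) (hB z hz).2
  have hfim : ∀ z ∈ Metric.ball z₀ r, (φ₁ z / φ₂ z).im = 0 := by
    intro z hz
    have h := him z (hB z hz).1
    simp only [Complex.mul_im, Complex.conj_re, Complex.conj_im] at h
    rw [Complex.div_im, ← sub_div, div_eq_zero_iff]
    left; linarith
  obtain ⟨w, hw⟩ := AnalyticOnNhd.eq_const_of_im_eq_const (c₀ := 0) hf hfim Metric.isOpen_ball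
    ((convex_ball z₀ r).isConnected (Metric.nonempty_ball.2 hr))
  have hz₀B := Metric.mem_ball_self (x := z₀) hr
  have hwr : ((w.re : ℝ) : ℂ) = w := by
    apply Complex.ext
    · simp
    · have := hfim z₀ hz₀B
      have h2 := hw z₀ hz₀B
      rw [h2] at this
      simp [this]
  refine ⟨w.re, ?_⟩
  rw [hwr]
  refine h₁.eqOn_of_preconnected_of_eventuallyEq (g := fun z => w * φ₂ z)
    (analyticOnNhd_const.mul h₂) hUc.isPreconnected hz₀ ?_
  filter_upwards [Metric.ball_mem_nhds z₀ hr] with z hz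
  exact (div_eq_iff (hB z hz).2).1 (hw z hz)
end
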